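/- arXiv:1306.2012 — 3 statements merged into one kernel-verified Lean document; each statement's English description precedes it below -/
import Mathlib

section
/- Let r ≥ 3 be a fixed integer. There exist constants C > 0 and δ > 0 depending only on r such that the following holds. For every n and every degree sequence k = (k_1,…,k_n) of nonnegative integers with sum M divisible by r, maximum degree k_max satisfying 2 ≤ k_max and k_max^3 ≤ δM, the number of simple r-uniform hypergraphs on vertex set {1,…,n} with degree sequence k equals (M! / ((M/r)! · (r!)^{M/r} · ∏_{i=1}^n k_i!)) · exp(−(r−1)M_2/(2M) + E) for some real E with |E| ≤ C·k_max^3/M, where M_2 = Σ_{i=1}^n k_i(k_i−1). -/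
open scoped Classical BigOperators

/-- The set of points for the configuration model: cell `i` contains `k i` points. -/
abbrev Pts {n : ℕ} (k : Fin n → ℕ) : Type := (i : Fin n) × Fin (k i)

/-- `M`, the total degree. -/
def Mtot {n : ℕ} (k : Fin n → ℕ) : ℕ := ∑ i, k i

/-- `M₂ = Σ kᵢ(kᵢ−1)`. -/
def M2 {n : ℕ} (k : Fin n → ℕ) : ℕ := ∑ i, k i * (k i - 1)

/-- `M₃ = Σ kᵢ(kᵢ−1)(kᵢ−2)`. -/
def M3 {n : ℕ} (k : Fin n → ℕ) : ℕ := ∑ i, k i * (k i - 1) * (k i - 2)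

/-- The maximum degree. -/
def kmax {n : ℕ} (k : Fin n → ℕ) : ℕ := Finset.univ.sup k

/-- `Q` is an unordered partition of the point set into parts of size `r`. -/
def IsPartition {n : ℕ} (r : ℕ) (k : Fin n → ℕ) (Q : Finset (Finset (Pts k))) : Prop :=
  (∀ U ∈ Q, U.card = r) ∧ ∀ p : Pts k, ∃! U, U ∈ Q ∧ p ∈ U

/-- `Λ_r(k)`, the set of partitions of the points into parts of size `r`. -/
def Lam {n : ℕ} (r : ℕ) (k : Fin n → ℕ) : Set (Finset (Finset (Pts k))) :=
  {Q | IsPartition r k Q}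

/-- `Λ_r(k)` as a finset. -/
noncomputable def LamFinset {n : ℕ} (r : ℕ) (k : Fin n → ℕ) :
    Finset (Finset (Finset (Pts k))) :=
  Finset.univ.filter fun Q => IsPartition r k Q

/-- The set of vertices of the edge of `G(Q)` corresponding to a part `U`. -/
def vset {n : ℕ} {k : Fin n → ℕ} (U : Finset (Pts k)) : Finset (Fin n) :=
  U.image Sigma.fst

/-- Multiplicity of vertex `i` in the edge corresponding to a part `U`. -/
def mult {n : ℕ} {k : Fin n → ℕ} (U : Finset (Pts k)) (i : Fin n) : ℕ :=
  (U.filter fun p => p.1 = i).card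

/-- `U` contains a loop: two distinct points lying in the same cell. -/
def HasLoop {n : ℕ} {k : Fin n → ℕ} (U : Finset (Pts k)) : Prop :=
  ∃ x ∈ U, ∃ y ∈ U, x ≠ y ∧ x.1 = y.1

/-- The number of parts of `Q` which contain a loop. -/
noncomputable def nloops {n : ℕ} {k : Fin n → ℕ} (Q : Finset (Finset (Pts k))) : ℕ :=
  (Q.filter fun U => HasLoop U).card

/-- `N = max(⌈log M⌉, ⌈9(r−1)M₂/M⌉)`. -/
noncomputable def Nbound {n : ℕ} (r : ℕ) (k : Fin n → ℕ) : ℕ :=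
  max ⌈Real.log (Mtot k)⌉₊ ⌈(9 * ((r : ℝ) - 1) * (M2 k : ℝ)) / (Mtot k : ℝ)⌉₊

/-- `Λ_r⁺(k)`: partitions satisfying properties (i)–(iv). -/
noncomputable def LamPlus {n : ℕ} (r : ℕ) (k : Fin n → ℕ) :
    Set (Finset (Finset (Pts k))) :=
  {Q | IsPartition r k Q ∧
    (∀ U ∈ Q, ∀ i, mult U i ≤ 2) ∧
    (∀ U ∈ Q, ∀ i j, mult U i = 2 → mult U j = 2 → i = j) ∧
    (∀ U ∈ Q, ∀ W ∈ Q, U ≠ W → (vset U ∩ vset W).card ≤ 2) ∧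
    nloops Q ≤ Nbound r k}

/-- `C_ℓ`: partitions in `Λ_r⁺(k)` with exactly `ℓ` parts containing a loop. -/
noncomputable def Cset {n : ℕ} (r : ℕ) (k : Fin n → ℕ) (ℓ : ℕ) :
    Set (Finset (Finset (Pts k))) :=
  {Q ∈ LamPlus r k | nloops Q = ℓ}

/-- The result of an ℓ-switching replacing parts `U`, `W₁`, `W₂`. -/
def switchResult {n : ℕ} {k : Fin n → ℕ} (Q : Finset (Finset (Pts k)))
    (U W₁ W₂ : Finset (Pts k)) (x₁ x₂ y₁ y₂ : Pts k) : Finset (Finset (Pts k)) :=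
  (Q \ {U, W₁, W₂}) ∪
    {(U \ {x₁, x₂}) ∪ {y₁, y₂}, (W₁ \ {y₁}) ∪ {x₁}, (W₂ \ {y₂}) ∪ {x₂}}

/-- `(x₁,x₂,y₁,y₂)` specifies an ℓ-switching in `Q` with parts `U`, `W₁`, `W₂`. -/
def IsSwitching {n : ℕ} {k : Fin n → ℕ} (Q : Finset (Finset (Pts k)))
    (U W₁ W₂ : Finset (Pts k)) (x₁ x₂ y₁ y₂ : Pts k) : Prop :=
  U ∈ Q ∧ W₁ ∈ Q ∧ W₂ ∈ Q ∧ U ≠ W₁ ∧ U ≠ W₂ ∧ W₁ ≠ W₂ ∧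
  x₁ ∈ U ∧ x₂ ∈ U ∧ x₁ ≠ x₂ ∧ x₁.1 = x₂.1 ∧
  y₁ ∈ W₁ ∧ y₂ ∈ W₂ ∧ y₁.1 ≠ y₂.1

/-- The result of a reverse ℓ-switching replacing parts `Û`, `Ŵ₁`, `Ŵ₂`. -/
def revSwitchResult {n : ℕ} {k : Fin n → ℕ} (Q' : Finset (Finset (Pts k)))
    (Uh W₁h W₂h : Finset (Pts k)) (x₁ x₂ y₁ y₂ : Pts k) : Finset (Finset (Pts k)) :=
  (Q' \ {Uh, W₁h, W₂h}) ∪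
    {(Uh \ {y₁, y₂}) ∪ {x₁, x₂}, (W₁h \ {x₁}) ∪ {y₁}, (W₂h \ {x₂}) ∪ {y₂}}

/-- `(x₁,x₂,y₁,y₂)` specifies a reverse ℓ-switching in `Q'` with parts `Û`, `Ŵ₁`, `Ŵ₂`. -/
def IsRevSwitching {n : ℕ} {k : Fin n → ℕ} (Q' : Finset (Finset (Pts k)))
    (Uh W₁h W₂h : Finset (Pts k)) (x₁ x₂ y₁ y₂ : Pts k) : Prop :=
  Uh ∈ Q' ∧ W₁h ∈ Q' ∧ W₂h ∈ Q' ∧ Uh ≠ W₁h ∧ Uh ≠ W₂h ∧ W₁h ≠ W₂h ∧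
  x₁ ∈ W₁h ∧ x₂ ∈ W₂h ∧ x₁.1 = x₂.1 ∧
  y₁ ∈ Uh ∧ y₂ ∈ Uh ∧ y₁ ≠ y₂ ∧ y₁.1 ≠ y₂.1

/-- `Q` is simple: every edge of `G(Q)` consists of distinct vertices and all
edges are distinct. -/
def SimpleQ {n : ℕ} {k : Fin n → ℕ} (Q : Finset (Finset (Pts k))) : Prop :=
  (∀ U ∈ Q, (vset U).card = U.card) ∧
  ∀ U ∈ Q, ∀ W ∈ Q, U ≠ W → vset U ≠ vset W

/-- `|H_r(k)|`: the number of simple `r`-uniform hypergraphs on `{1,…,n}` with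
degree sequence `k`, a hypergraph being recorded as its (distinct) edge set. -/
noncomputable def Hcount (r : ℕ) {n : ℕ} (k : Fin n → ℕ) : ℕ :=
  Set.ncard {E : Finset (Finset (Fin n)) |
    (∀ e ∈ E, e.card = r) ∧ ∀ i, (E.filter fun e => i ∈ e).card = k i}

section Generic
variable {P J R ι : Type} [Fintype P] [Fintype J] [Fintype R]
  [DecidableEq P] [DecidableEq J] [DecidableEq R]

/-- placements without two points of `T` of the same label in one row -/
noncomputable def SS (c : P → ι) (T : Finset P) : Finset (P ≃ J × R) :=
  Finset.univ.filter fun σ => ∀ x ∈ T, ∀ y ∈ T, x ≠ y → c x = c y → (σ x).1 ≠ (σ y).1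

def Ok (c : P → ι) (σ : P ≃ J × R) (p z : P) : Prop :=
  (∀ y, (σ y).1 = (σ p).1 → c y ≠ c z) ∧ (∀ y, (σ y).1 = (σ z).1 → c y ≠ c p)

lemma mem_SS {c : P → ι} {T : Finset P} {σ : P ≃ J × R} : σ ∈ SS c T ↔
    ∀ x ∈ T, ∀ y ∈ T, x ≠ y → c x = c y → (σ x).1 ≠ (σ y).1 := by
  simp [SS]

lemma card_row (σ : P ≃ J × R) (j : J) :
    (Finset.univ.filter fun y => (σ y).1 = j).card = Fintype.card R := by
  rw [← Finset.card_univ]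
  symm
  apply Finset.card_bij (fun b _ => σ.symm (j, b))
  · intro b _; simp
  · intro a _ b _ h
    simpa using h
  · intro y hy
    refine ⟨(σ y).2, Finset.mem_univ _, ?_⟩
    simp only [Finset.mem_filter, Finset.mem_univ, true_and] at hy
    rw [Equiv.symm_apply_eq, ← hy]

lemma card_not_ok (c : P → ι) (K : ℕ) (hK : ∀ i, (Finset.univ.filter fun x => c x = i).card ≤ K)
    (σ : P ≃ J × R) (p : P) :
    (Finset.univ.filter fun z => ¬ Ok c σ p z).card ≤ 2 * Fintype.card R * K := by
  have hsub : (Finset.univ.filter fun z => ¬ Ok c σ p z) ⊆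
      ((Finset.univ.filter fun y => (σ y).1 = (σ p).1).biUnion
        fun y => Finset.univ.filter fun z => c z = c y) ∪
      ((Finset.univ.filter fun y => c y = c p).biUnion
        fun y => Finset.univ.filter fun z => (σ z).1 = (σ y).1) := by
    intro z hz
    simp only [Finset.mem_filter, Finset.mem_univ, true_and, Finset.mem_union,
      Finset.mem_biUnion] at hz ⊢
    unfold Ok at hz
    rw [not_and_or] at hz
    push Not at hz
    rcases hz with ⟨y, h1, h2⟩ | ⟨y, h1, h2⟩
    · exact Or.inl ⟨y, h1, h2.symm⟩
    · exact Or.inr ⟨y, h2, h1.symm⟩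
  refine (Finset.card_le_card hsub).trans ((Finset.card_union_le _ _).trans ?_)
  have h1 := Finset.card_biUnion_le_card_mul (Finset.univ.filter fun y => (σ y).1 = (σ p).1)
    (fun y => Finset.univ.filter fun z => c z = c y) K (fun y _ => hK _)
  have h2 := Finset.card_biUnion_le_card_mul (Finset.univ.filter fun y => c y = c p)
    (fun y => Finset.univ.filter fun z => (σ z).1 = (σ y).1) (Fintype.card R)
    (fun y _ => (card_row σ _).le)
  rw [card_row] at h1
  have h3 := Nat.mul_le_mul_right (Fintype.card R) (hK (c p))
  nlinarith

lemma ok_swap {c : P → ι} {T : Finset P} {σ : P ≃ J × R} {p z : P} (hσ : σ ∈ SS c T)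
    (h : Ok c σ p z) : (Equiv.swap p z).trans σ ∈ SS c T := by
  rw [mem_SS] at hσ ⊢
  intro x hx y hy hxy hc
  obtain ⟨h1, h2⟩ := h
  have hpz : c p ≠ c z := h1 p rfl
  simp only [Equiv.trans_apply]
  have key : ∀ x y, x ∈ T → y ∈ T → x ≠ y → c x = c y → x = p →
      (σ (Equiv.swap p z x)).1 ≠ (σ (Equiv.swap p z y)).1 := by
    intro x y hx hy hxy hc e
    subst e
    rw [Equiv.swap_apply_left, Equiv.swap_apply_of_ne_of_ne (Ne.symm hxy)
      (fun e => hpz (by rw [hc, e]))]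
    intro e; exact h2 y e.symm hc.symm
  have key2 : ∀ x y, x ∈ T → y ∈ T → x ≠ y → c x = c y → x = z →
      (σ (Equiv.swap p z x)).1 ≠ (σ (Equiv.swap p z y)).1 := by
    intro x y hx hy hxy hc e
    subst e
    rw [Equiv.swap_apply_right, Equiv.swap_apply_of_ne_of_ne 
      (fun e => hpz (by rw [hc, e])) (Ne.symm hxy)]
    intro e; exact h1 y e.symm hc.symm
  by_cases a1 : x = p
  · exact key x y hx hy hxy hc a1
  by_cases a2 : x = z
  · exact key2 x y hx hy hxy hc a2
  by_cases a3 : y = p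
  · exact (key y x hy hx hxy.symm hc.symm a3).symm
  by_cases a4 : y = z
  · exact (key2 y x hy hx hxy.symm hc.symm a4).symm
  rw [Equiv.swap_apply_of_ne_of_ne a1 a2, Equiv.swap_apply_of_ne_of_ne a3 a4]
  exact hσ x hx y hy hxy hc

noncomputable def XX (c : P → ι) (T : Finset P) (L : List (P × (J × R))) : Finset (P ≃ J × R) :=
  (SS c T).filter fun σ => ∀ a ∈ L, σ a.1 = a.2

lemma XX_bound (c : P → ι) (K : ℕ) (hK : ∀ i, (Finset.univ.filter fun x => c x = i).card ≤ K)
    (T : Finset P) (hM : 4 * Fintype.card R * K + 12 ≤ Fintype.card P)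
    (L : List (P × (J × R))) (hL : (L.map Prod.fst).Nodup) (hlen : L.length ≤ 6) :
    (XX c T L).card * Fintype.card P ^ L.length ≤ 2 ^ L.length * (SS c T (J := J) (R := R)).card := by
  induction L with
  | nil => simp [XX]
  | cons a L ih =>
    obtain ⟨p, s⟩ := a
    simp only [List.map_cons, List.nodup_cons, List.length_cons] at hL hlen
    have ih' := ih hL.2 (by omega)
    have step : (XX c T ((p, s) :: L)).card * Fintype.card P ≤ 2 * (XX c T L).card := by
      let Z : (P ≃ J × R) → Finset P := fun σ =>
        Finset.univ.filter fun z => Ok c σ p z ∧ z ∉ L.map Prod.fst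
      have hZ : ∀ σ, Fintype.card P ≤ 2 * (Z σ).card := by
        intro σ
        have hun : (Finset.univ : Finset P) ⊆ Z σ ∪ ((Finset.univ.filter fun z => ¬ Ok c σ p z) ∪
            (L.map Prod.fst).toFinset) := by
          intro z _
          simp only [Z, Finset.mem_union, Finset.mem_filter, Finset.mem_univ, true_and,
            List.mem_toFinset]
          tauto
        have h1 := Finset.card_le_card hun
        have h2 := Finset.card_union_le (Z σ) ((Finset.univ.filter fun z => ¬ Ok c σ p z) ∪
            (L.map Prod.fst).toFinset)
        have h3 := Finset.card_union_le (Finset.univ.filter fun z => ¬ Ok c σ p z) 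
            (L.map Prod.fst).toFinset
        have h4 := List.toFinset_card_le (L.map Prod.fst)
        have h5 := card_not_ok c K hK σ p
        rw [Finset.card_univ] at h1
        rw [List.length_map] at h4
        nlinarith
      have hinj : ((XX c T ((p, s) :: L)).sigma Z).card ≤ (XX c T L).card := by
        apply Finset.card_le_card_of_injOn (fun a => (Equiv.swap p a.2).trans a.1)
        · rintro ⟨σ, z⟩ h
          simp only [Finset.coe_sigma, Set.mem_sigma_iff, Finset.mem_coe, XX, Finset.mem_filter, Z,
            Finset.mem_univ, true_and, List.mem_cons, forall_eq_or_imp] at h ⊢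
          obtain ⟨⟨h1, h2, h3⟩, h4, h5⟩ := h
          refine ⟨ok_swap h1 h4, ?_⟩
          intro a ha
          rw [Equiv.trans_apply, Equiv.swap_apply_of_ne_of_ne]
          · exact h3 a ha
          · rintro rfl; exact hL.1 (List.mem_map_of_mem ha)
          · rintro rfl; exact h5 (List.mem_map_of_mem ha)
        · rintro ⟨σ, z⟩ h ⟨σ', z'⟩ h' heq
          simp only [Finset.coe_sigma, Set.mem_sigma_iff, Finset.mem_coe, XX, Finset.mem_filter, Z,
            Finset.mem_univ, true_and, List.mem_cons, forall_eq_or_imp] at h h' heq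
          have e1 : z = z' := by
            have a1 : ((Equiv.swap p z).trans σ) z = s := by simp [h.1.2.1]
            have a2 : ((Equiv.swap p z').trans σ') z' = s := by simp [h'.1.2.1]
            rw [heq] at a1
            exact Equiv.injective _ (a1.trans a2.symm)
          subst e1
          have e2 : σ = σ' := by
            ext1 x
            have := congrArg (fun f => f (Equiv.swap p z x)) heq
            simpa using this
          rw [e2]
      rw [Finset.card_sigma] at hinj
      calc (XX c T ((p, s) :: L)).card * Fintype.card P
          = ∑ σ ∈ XX c T ((p, s) :: L), Fintype.card P := by simp
        _ ≤ ∑ σ ∈ XX c T ((p, s) :: L), 2 * (Z σ).card := Finset.sum_le_sum fun σ _ => hZ σ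
        _ = 2 * ∑ σ ∈ XX c T ((p, s) :: L), (Z σ).card := by rw [Finset.mul_sum]
        _ ≤ _ := by gcongr
    simp only [List.length_cons]
    calc _ = (XX c T ((p, s) :: L)).card * Fintype.card P * Fintype.card P ^ L.length := by ring
      _ ≤ 2 * (XX c T L).card * Fintype.card P ^ L.length := by gcongr
      _ = 2 * ((XX c T L).card * Fintype.card P ^ L.length) := by ring
      _ ≤ 2 * (2 ^ L.length * (SS c T (J := J) (R := R)).card) := by gcongr
      _ = _ := by ring

end Generic

section Generic2
variable {P J R ι : Type} [Fintype P] [Fintype J] [Fintype R]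
  [DecidableEq P] [DecidableEq J] [DecidableEq R]

lemma card_pairs (c : P → ι) (K : ℕ) (hK : ∀ i, (Finset.univ.filter fun x => c x = i).card ≤ K) :
    ((Finset.univ : Finset (P × P)).filter fun a => c a.1 = c a.2).card ≤ Fintype.card P * K := by
  have h : ((Finset.univ : Finset (P × P)).filter fun a => c a.1 = c a.2) ⊆
      (Finset.univ : Finset P).biUnion fun x =>
        (Finset.univ.filter fun y => c y = c x).image fun y => (x, y) := by
    rintro ⟨x, y⟩ hxy
    simp only [Finset.mem_filter, Finset.mem_univ, true_and, Finset.mem_biUnion,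
      Finset.mem_image] at hxy ⊢
    exact ⟨x, y, hxy.symm, rfl⟩
  refine (Finset.card_le_card h).trans ?_
  exact Finset.card_biUnion_le_card_mul _ _ K fun x _ => Finset.card_image_le.trans (hK _)

/-- the bad placements -/
noncomputable def BB (c : P → ι) (T : Finset P) (p : P) : Finset (P ≃ J × R) :=
  (SS c T).filter fun σ => ∃ q ∈ T, c q = c p ∧ (σ q).1 = (σ p).1

lemma mem_SS_insert {c : P → ι} {T : Finset P} {p : P} (hp : p ∉ T) {σ : P ≃ J × R} :
    σ ∈ SS c (insert p T) ↔ σ ∈ SS c T ∧ ∀ q ∈ T, c q = c p → (σ q).1 ≠ (σ p).1 := by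
  simp only [mem_SS, Finset.mem_insert, forall_eq_or_imp]
  constructor
  · rintro ⟨h1, h2⟩
    exact ⟨fun x hx y hy => (h2 x hx).2 y hy, fun q hq hc => (h2 q hq).1
      (fun e => hp (e ▸ hq)) hc⟩
  · rintro ⟨h1, h2⟩
    refine ⟨⟨fun h => absurd rfl h, fun q hq _ hc => (h2 q hq hc.symm).symm⟩, ?_⟩
    intro x hx
    exact ⟨fun _ hc => h2 x hx hc, fun y hy => h1 x hx y hy⟩

lemma card_split (c : P → ι) {T : Finset P} {p : P} (hp : p ∉ T) :
    (BB c T p (J := J) (R := R)).card + (SS c (insert p T) (J := J) (R := R)).card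
      = (SS c T (J := J) (R := R)).card := by
  have : SS c (insert p T) (J := J) (R := R) =
      (SS c T).filter fun σ => ¬ ∃ q ∈ T, c q = c p ∧ (σ q).1 = (σ p).1 := by
    ext σ
    rw [mem_SS_insert hp, Finset.mem_filter]
    push Not
    rfl
  rw [this, BB, Finset.card_filter_add_card_filter_not]

lemma swap_swap' (p x : P) (σ : P ≃ J × R) :
    (Equiv.swap p x).trans ((Equiv.swap p x).trans σ) = σ := by
  ext1 y; simp

lemma double_count (p : P) (B G : Finset (P ≃ J × R)) :
    ∑ σ ∈ B, (Finset.univ.filter fun x => (Equiv.swap p x).trans σ ∈ G).card =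
    ∑ σ ∈ G, (Finset.univ.filter fun x => (Equiv.swap p x).trans σ ∈ B).card := by
  rw [← Finset.card_sigma, ← Finset.card_sigma]
  apply Finset.card_bij (fun a _ => ⟨(Equiv.swap p a.2).trans a.1, a.2⟩)
  · rintro ⟨σ, x⟩ h
    simp only [Finset.mem_sigma, Finset.mem_filter, Finset.mem_univ, true_and] at h ⊢
    rw [swap_swap']
    exact h.symm
  · rintro ⟨σ, x⟩ h ⟨σ', x'⟩ h' heq
    simp only [Sigma.mk.injEq, heq_eq_eq] at heq
    obtain ⟨h1, rfl⟩ := heq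
    rw [← swap_swap' p x σ, h1, swap_swap']
  · rintro ⟨σ, x⟩ h
    simp only [Finset.mem_sigma, Finset.mem_filter, Finset.mem_univ, true_and] at h
    refine ⟨⟨(Equiv.swap p x).trans σ, x⟩, ?_, ?_⟩
    · simp only [Finset.mem_sigma, Finset.mem_filter, Finset.mem_univ, true_and]
      rw [swap_swap']
      exact h.symm
    · simp only [swap_swap']

noncomputable def QQ (c : P → ι) (T : Finset P) (p : P) : Finset P :=
  T.filter fun q => c q = c p

noncomputable def Xs (c : P → ι) (T : Finset P) (p : P) (σ : P ≃ J × R) : Finset P :=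
  (QQ c T p).biUnion fun q => (Finset.univ.filter fun x => (σ x).1 = (σ q).1).erase q

noncomputable def Ys (c : P → ι) (T : Finset P) (p : P) (σ : P ≃ J × R) : Finset P :=
  (Xs c T p σ).filter fun x => x ∈ T ∧ ∃ y ∈ T, y ≠ x ∧ c y = c x ∧ (σ y).1 = (σ p).1

lemma mem_Xs {c : P → ι} {T : Finset P} {p : P} {σ : P ≃ J × R} {x : P} :
    x ∈ Xs c T p σ ↔ ∃ q, (q ∈ T ∧ c q = c p) ∧ x ≠ q ∧ (σ x).1 = (σ q).1 := by
  simp [Xs, QQ]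

lemma card_Xs {c : P → ι} {T : Finset P} {p : P} {σ : P ≃ J × R} (hσ : σ ∈ SS c T) :
    (Xs c T p σ).card = (QQ c T p).card * (Fintype.card R - 1) := by
  rw [Xs, Finset.card_biUnion]
  · rw [Finset.sum_const_nat]
    intro q _
    rw [Finset.card_erase_of_mem (by simp), card_row]
  · intro q hq q' hq' hne
    simp only [QQ, Finset.coe_filter, Set.mem_setOf_eq, Finset.mem_filter] at hq hq'
    rw [Function.onFun, Finset.disjoint_left]
    intro x hx hx'
    simp only [Finset.mem_erase, Finset.mem_filter, Finset.mem_univ, true_and] at hx hx'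
    exact (mem_SS.1 hσ) q hq.1 q' hq'.1 hne (hq.2.trans hq'.2.symm) (hx.2.symm.trans hx'.2)

lemma back_sub {c : P → ι} {T : Finset P} {p : P} (hp : p ∉ T) {σ : P ≃ J × R}
    (hσ : σ ∈ SS c (insert p T)) :
    (Finset.univ.filter fun x => (Equiv.swap p x).trans σ ∈ BB c T p) ⊆ Xs c T p σ := by
  intro x hx
  rw [mem_SS_insert hp] at hσ
  simp only [BB, Finset.mem_filter, Finset.mem_univ, true_and, Equiv.trans_apply,
    Equiv.swap_apply_left] at hx
  obtain ⟨h1, q, hq, hc, hrow⟩ := hx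
  have hqp : q ≠ p := fun e => hp (e ▸ hq)
  rw [mem_Xs]
  by_cases hqx : x = q
  · subst hqx
    rw [Equiv.swap_apply_right] at hrow
    exact absurd hrow.symm (hσ.2 x hq hc)
  · rw [Equiv.swap_apply_of_ne_of_ne hqp (Ne.symm hqx)] at hrow
    exact ⟨q, ⟨hq, hc⟩, hqx, hrow.symm⟩

lemma sub_back {c : P → ι} {T : Finset P} {p : P} (hp : p ∉ T) {σ : P ≃ J × R}
    (hσ : σ ∈ SS c (insert p T)) :
    Xs c T p σ ⊆ (Finset.univ.filter fun x => (Equiv.swap p x).trans σ ∈ BB c T p) ∪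
      Ys c T p σ := by
  intro x hx
  by_cases hy : x ∈ Ys c T p σ
  · exact Finset.mem_union_right _ hy
  apply Finset.mem_union_left
  have hy' : x ∈ T → ∀ y ∈ T, y ≠ x → c y = c x → (σ y).1 ≠ (σ p).1 := by
    intro h1 y h2 h3 h4 h5
    exact hy (Finset.mem_filter.2 ⟨hx, h1, y, h2, h3, h4, h5⟩)
  rw [mem_Xs] at hx
  rw [mem_SS_insert hp] at hσ
  obtain ⟨q, ⟨hq, hc⟩, hxq, hrow⟩ := hx
  have hqp : q ≠ p := fun e => hp (e ▸ hq)
  simp only [BB, Finset.mem_filter, Finset.mem_univ, true_and, Equiv.trans_apply,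
    Equiv.swap_apply_left]
  refine ⟨?_, q, hq, hc, ?_⟩
  · rw [mem_SS]
    have key : ∀ y ∈ T, y ≠ p := fun y hy e => hp (e ▸ hy)
    intro a ha b hb hab hcab
    simp only [Equiv.trans_apply]
    by_cases hax : a = x
    · subst hax
      rw [Equiv.swap_apply_right, Equiv.swap_apply_of_ne_of_ne (key b hb) (Ne.symm hab)]
      exact (hy' ha b hb (Ne.symm hab) hcab.symm).symm
    by_cases hbx : b = x
    · subst hbx
      rw [Equiv.swap_apply_right, Equiv.swap_apply_of_ne_of_ne (key a ha) hab]
      exact (hy' hb a ha hab hcab)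
    rw [Equiv.swap_apply_of_ne_of_ne (key a ha) hax, Equiv.swap_apply_of_ne_of_ne (key b hb) hbx]
    exact mem_SS.1 hσ.1 a ha b hb hab hcab
  · rw [Equiv.swap_apply_of_ne_of_ne hqp (Ne.symm hxq)]
    exact hrow.symm

lemma fwd_count {c : P → ι} {K : ℕ} (hK : ∀ i, (Finset.univ.filter fun x => c x = i).card ≤ K)
    {T : Finset P} {p : P} (hp : p ∉ T) {σ : P ≃ J × R} (hσ : σ ∈ BB c T p) :
    Fintype.card P ≤
      (Finset.univ.filter fun x => (Equiv.swap p x).trans σ ∈ SS c (insert p T)).card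
        + 2 * Fintype.card R * K := by
  have hun : (Finset.univ : Finset P) ⊆
      (Finset.univ.filter fun x => (Equiv.swap p x).trans σ ∈ SS c (insert p T)) ∪
      (Finset.univ.filter fun z => ¬ Ok c σ p z) := by
    intro z _
    by_cases hz : Ok c σ p z
    · apply Finset.mem_union_left
      simp only [Finset.mem_filter, Finset.mem_univ, true_and]
      rw [mem_SS_insert hp]
      refine ⟨ok_swap (Finset.mem_filter.1 hσ).1 hz, ?_⟩
      intro q hq hc
      have hqp : q ≠ p := fun e => hp (e ▸ hq)
      have hqz : q ≠ z := by
        rintro rfl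
        exact hz.1 p rfl hc.symm
      simp only [Equiv.trans_apply, Equiv.swap_apply_left]
      rw [Equiv.swap_apply_of_ne_of_ne hqp hqz]
      intro e
      exact hz.2 q e hc
    · apply Finset.mem_union_right
      simp [hz]
  have h1 := Finset.card_le_card hun
  have h2 := Finset.card_union_le
    (Finset.univ.filter fun x => (Equiv.swap p x).trans σ ∈ SS c (insert p T))
    (Finset.univ.filter fun z => ¬ Ok c σ p z)
  have h3 := card_not_ok c K hK σ p
  rw [Finset.card_univ] at h1
  omega

lemma upperB {c : P → ι} {K : ℕ} (hK : ∀ i, (Finset.univ.filter fun x => c x = i).card ≤ K)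
    {T : Finset P} {p : P} (hp : p ∉ T) :
    (BB c T p (J := J) (R := R)).card * Fintype.card P ≤
      (QQ c T p).card * (Fintype.card R - 1) * (SS c (insert p T) (J := J) (R := R)).card +
      2 * Fintype.card R * K * (BB c T p (J := J) (R := R)).card := by
  have h1 : ∑ σ ∈ BB c T p (J := J) (R := R), Fintype.card P ≤ ∑ σ ∈ BB c T p (J := J) (R := R),
      ((Finset.univ.filter fun x => (Equiv.swap p x).trans σ ∈ SS c (insert p T)).card
        + 2 * Fintype.card R * K) := Finset.sum_le_sum fun σ hσ => fwd_count hK hp hσ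
  rw [Finset.sum_add_distrib, double_count] at h1
  have h2 : ∑ σ ∈ SS c (insert p T) (J := J) (R := R),
      (Finset.univ.filter fun x => (Equiv.swap p x).trans σ ∈ BB c T p).card ≤
      ∑ σ ∈ SS c (insert p T) (J := J) (R := R), (QQ c T p).card * (Fintype.card R - 1) := by
    apply Finset.sum_le_sum
    intro σ hσ
    rw [← card_Xs ((mem_SS_insert hp).1 hσ).1]
    exact Finset.card_le_card (back_sub hp hσ)
  simp only [Finset.sum_const, smul_eq_mul] at h1 h2
  nlinarith

lemma lowerB {c : P → ι} {T : Finset P} {p : P} (hp : p ∉ T) :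
    (QQ c T p).card * (Fintype.card R - 1) * (SS c (insert p T) (J := J) (R := R)).card ≤
      (BB c T p (J := J) (R := R)).card * Fintype.card P +
      ∑ σ ∈ SS c (insert p T) (J := J) (R := R), (Ys c T p σ).card := by
  have h2 : ∑ σ ∈ SS c (insert p T) (J := J) (R := R), (QQ c T p).card * (Fintype.card R - 1) ≤
      ∑ σ ∈ SS c (insert p T) (J := J) (R := R),
      ((Finset.univ.filter fun x => (Equiv.swap p x).trans σ ∈ BB c T p).card +
        (Ys c T p σ).card) := by
    apply Finset.sum_le_sum
    intro σ hσ
    rw [← card_Xs ((mem_SS_insert hp).1 hσ).1]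
    exact (Finset.card_le_card (sub_back hp hσ)).trans (Finset.card_union_le _ _)
  rw [Finset.sum_add_distrib, ← double_count] at h2
  have h1 : ∑ σ ∈ BB c T p (J := J) (R := R),
      (Finset.univ.filter fun x => (Equiv.swap p x).trans σ ∈ SS c (insert p T)).card ≤
      ∑ σ ∈ BB c T p (J := J) (R := R), Fintype.card P :=
    Finset.sum_le_sum fun σ hσ => Finset.card_le_univ _
  simp only [Finset.sum_const, smul_eq_mul] at h1 h2
  nlinarith

lemma W_bound {c : P → ι} {K : ℕ} (hK : ∀ i, (Finset.univ.filter fun x => c x = i).card ≤ K)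
    {T : Finset P} {p : P} (hp : p ∉ T) (hM : 4 * Fintype.card R * K + 12 ≤ Fintype.card P)
    (hJ : Fintype.card J * Fintype.card R = Fintype.card P) :
    (∑ σ ∈ SS c (insert p T) (J := J) (R := R), (Ys c T p σ).card) * Fintype.card P ^ 4 ≤
      16 * (QQ c T p).card * K * Fintype.card R ^ 2 * Fintype.card P ^ 3 *
        (SS c T (J := J) (R := R)).card := by
  let Ω : Finset ((P ≃ J × R) × P × P × P) := Finset.univ.filter fun a =>
    a.1 ∈ SS c T ∧ a.2.1 ∈ QQ c T p ∧ c a.2.2.1 = c a.2.2.2 ∧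
    [a.2.1, a.2.2.1, a.2.2.2, p].Nodup ∧ (a.1 a.2.2.1).1 = (a.1 a.2.1).1 ∧
    (a.1 p).1 = (a.1 a.2.2.2).1
  have hW : ∑ σ ∈ SS c (insert p T) (J := J) (R := R), (Ys c T p σ).card ≤ Ω.card := by
    rw [← Finset.card_sigma]
    have : ((SS c (insert p T) (J := J) (R := R)).sigma fun σ => Ys c T p σ) ⊆
        Ω.image fun a => ⟨a.1, a.2.2.1⟩ := by
      rintro ⟨σ, x⟩ h
      simp only [Finset.mem_sigma, Ys, Finset.mem_filter] at h
      obtain ⟨h1, h2, h3, y, h4, h5, h6, h7⟩ := h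
      rw [mem_Xs] at h2
      rw [mem_SS_insert hp] at h1
      obtain ⟨q, ⟨hq, hc⟩, hxq, hrow⟩ := h2
      refine Finset.mem_image.2 ⟨(σ, q, x, y), ?_, rfl⟩
      have key : ∀ y ∈ T, y ≠ p := fun y hy e => hp (e ▸ hy)
      have hqy : q ≠ y := by
        rintro rfl
        exact h1.2 q hq hc h7
      simp only [Ω, Finset.mem_filter, Finset.mem_univ, true_and, QQ]
      refine ⟨h1.1, ⟨hq, hc⟩, h6.symm, ?_, hrow, h7.symm⟩
      simp [Ne.symm hxq, hqy, key q hq, Ne.symm h5, key x h3, key y h4]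
    exact (Finset.card_le_card this).trans Finset.card_image_le
  let t : Finset ((P × P × P) × ((J × R) × R × (J × R) × R)) :=
    ((QQ c T p) ×ˢ ((Finset.univ : Finset (P × P)).filter fun a => c a.1 = c a.2)) ×ˢ Finset.univ
  let f : ((P ≃ J × R) × P × P × P) → ((P × P × P) × ((J × R) × R × (J × R) × R)) :=
    fun a => (a.2, (a.1 a.2.1, (a.1 a.2.2.1).2, a.1 a.2.2.2, (a.1 p).2))
  have hf : ∀ a ∈ Ω, f a ∈ t := by
    rintro ⟨σ, q, x, y⟩ h
    simp only [Ω, Finset.mem_filter, Finset.mem_univ, true_and] at h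
    simp [t, f, h.2.1, h.2.2.1]
  have hfib : ∀ b ∈ t, (Ω.filter fun a => f a = b).card * Fintype.card P ^ 4 ≤
      16 * (SS c T (J := J) (R := R)).card := by
    rintro ⟨⟨q, x, y⟩, s1, b1, s2, b2⟩ hb
    by_cases hnd : [q, x, y, p].Nodup
    · have hX := XX_bound (J := J) (R := R) c K hK T hM
        [(q, s1), (x, (s1.1, b1)), (y, s2), (p, (s2.1, b2))] (by simpa using hnd) (by simp)
      simp only [List.length_cons, List.length_nil, zero_add, Nat.reduceAdd] at hX
      norm_num at hX
      refine le_trans (Nat.mul_le_mul_right _ ?_) hX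
      apply Finset.card_le_card_of_injOn (fun a => a.1)
      · rintro ⟨σ, q', x', y'⟩ h
        simp only [Ω, f, Finset.coe_filter, Set.mem_setOf_eq, Finset.mem_filter, Finset.mem_univ,
          true_and, Prod.mk.injEq] at h
        obtain ⟨⟨h1, h2, h3, h4, h5, h6⟩, ⟨rfl, rfl, rfl⟩, rfl, rfl, rfl, rfl⟩ := h
        simp only [XX, Finset.coe_filter, Set.mem_setOf_eq]
        refine ⟨h1, ?_⟩
        simp [← h5, ← h6]
      · rintro ⟨σ, q', x', y'⟩ h ⟨σ', q'', x'', y''⟩ h' heq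
        simp only [Ω, f, Finset.coe_filter, Set.mem_setOf_eq, Finset.mem_filter, Finset.mem_univ,
          true_and, Prod.mk.injEq] at h h' heq
        obtain ⟨-, ⟨rfl, rfl, rfl⟩, -⟩ := h
        obtain ⟨-, ⟨rfl, rfl, rfl⟩, -⟩ := h'
        rw [heq]
    · have : (Ω.filter fun a => f a = ((q, x, y), s1, b1, s2, b2)) = ∅ := by
        rw [Finset.filter_eq_empty_iff]
        rintro ⟨σ, q', x', y'⟩ h heq
        simp only [f, Prod.mk.injEq] at heq
        obtain ⟨⟨rfl, rfl, rfl⟩, -⟩ := heq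
        exact hnd (Finset.mem_filter.1 h).2.2.2.2.1
      rw [this]; simp
  have htot : Ω.card * Fintype.card P ^ 4 ≤ t.card * (16 * (SS c T (J := J) (R := R)).card) := by
    rw [Finset.card_eq_sum_card_fiberwise hf, Finset.sum_mul]
    refine (Finset.sum_le_sum hfib).trans ?_
    simp
  have ht : t.card ≤ (QQ c T p).card * (Fintype.card P * K) *
      (Fintype.card P * (Fintype.card R * (Fintype.card P * Fintype.card R))) := by
    simp only [t, Finset.card_product, Finset.card_univ, Fintype.card_prod, hJ]
    have := card_pairs c K hK
    gcongr
  calc _ ≤ Ω.card * Fintype.card P ^ 4 := Nat.mul_le_mul_right _ hW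
    _ ≤ _ := htot
    _ ≤ _ := Nat.mul_le_mul_right _ ht
    _ = _ := by ring

end Generic2

lemma real_step (M K a r S B G W : ℝ) (hBG : B + G = S) (hB : 0 ≤ B)
    (h1 : B * M ≤ a * (r - 1) * G + 2 * r * K * B)
    (h2 : a * (r - 1) * G ≤ B * M + W) (h3 : W * M ≤ 16 * a * K * r ^ 2 * S)
    (ha : 0 ≤ a) (haK : a ≤ K) (hM : 16 * r * K ≤ M) (hMpos : 0 < M) (hr : 1 ≤ r) (hS : 0 < S) :
    0 < G ∧ |Real.log G - Real.log S + a * (r - 1) / M| ≤ 26 * r ^ 2 * a * K / M ^ 2 := by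
  have hK : 0 ≤ K := ha.trans haK
  obtain ⟨b, rfl⟩ : ∃ b, B = b * S := ⟨B / S, by field_simp⟩
  obtain ⟨w, rfl⟩ : ∃ w, W = w * S := ⟨W / S, by field_simp⟩
  have hG : G = (1 - b) * S := by linarith
  subst hG
  have hb : 0 ≤ b := nonneg_of_mul_nonneg_left hB hS
  have h1' : b * M ≤ a * (r - 1) * (1 - b) + 2 * r * K * b := by
    apply le_of_mul_le_mul_right _ hS; nlinarith
  have h2' : a * (r - 1) * (1 - b) ≤ b * M + w := by
    apply le_of_mul_le_mul_right _ hS; nlinarith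
  have h3' : w * M ≤ 16 * a * K * r ^ 2 := by
    apply le_of_mul_le_mul_right _ hS; nlinarith
  clear h1 h2 h3 hB hBG
  have har : 0 ≤ a * (r - 1) := mul_nonneg ha (by linarith)
  have hrK : r * K * b ≤ M * b / 16 := by nlinarith
  have hbM : b * M ≤ 2 * a * r := by nlinarith [mul_nonneg har hb]
  have haKr : a * r ≤ M / 16 := by nlinarith
  have hb8 : b ≤ 1 / 8 := by
    by_contra h
    push Not at h
    nlinarith
  set u : ℝ := r ^ 2 * a * K / M with hu
  have hu0 : 0 ≤ u := by positivity
  have hrKb : r * K * b ≤ 2 * u := by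
    rw [hu, mul_div_assoc', le_div_iff₀ hMpos]
    nlinarith [mul_le_mul_of_nonneg_left hbM (by positivity : 0 ≤ r * K)]
  have harb : a * (r - 1) * b ≤ 2 * u := by
    have : a * (r - 1) * b ≤ r * K * b := by
      apply mul_le_mul_of_nonneg_right _ hb
      nlinarith
    linarith
  have hw : w ≤ 16 * u := by
    rw [hu, mul_div_assoc', le_div_iff₀ hMpos]
    nlinarith
  have hbb : b * b * M ≤ 4 * u := by
    have : b * (b * M) ≤ b * (2 * a * r) := mul_le_mul_of_nonneg_left hbM hb
    have : b * (a * r) ≤ b * (r * K) := by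
      apply mul_le_mul_of_nonneg_left _ hb; nlinarith
    nlinarith
  have hpos : 0 < 1 - b := by linarith
  refine ⟨by positivity, ?_⟩
  rw [Real.log_mul hpos.ne' hS.ne', add_sub_cancel_right]
  have hlog1 := Real.log_le_sub_one_of_pos hpos
  have hlog2 := Real.one_sub_inv_le_log_of_pos hpos
  have hlog3 : -b - 2 * b ^ 2 ≤ 1 - (1 - b)⁻¹ := by
    rw [← sub_nonneg]
    have : 1 - (1 - b)⁻¹ - (-b - 2 * b ^ 2) = b ^ 2 * (1 - 2 * b) / (1 - b) := by
      field_simp; ring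
    rw [this]
    apply div_nonneg _ hpos.le
    apply mul_nonneg (by positivity) (by linarith)
  have hE : 26 * r ^ 2 * a * K / M ^ 2 = 26 * u / M := by
    rw [hu]; field_simp
  rw [hE]
  have e1 : (Real.log (1 - b) + a * (r - 1) / M) = (Real.log (1 - b) * M + a * (r - 1)) / M := by
    field_simp
  rw [e1, abs_div, abs_of_pos hMpos]
  gcongr
  rw [abs_le]
  constructor
  · nlinarith
  · nlinarith

section Generic3
variable {P J R ι : Type} [Fintype P] [Fintype J] [Fintype R]
  [DecidableEq P] [DecidableEq J] [DecidableEq R]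

noncomputable def e2 (c : P → ι) (T : Finset P) : ℕ :=
  (T.offDiag.filter fun a => c a.1 = c a.2).card

lemma e2_insert (c : P → ι) {T : Finset P} {p : P} (hp : p ∉ T) :
    e2 c (insert p T) = e2 c T + 2 * (QQ c T p).card := by
  unfold e2 QQ
  rw [Finset.offDiag_insert hp, Finset.filter_union, Finset.filter_union,
    Finset.card_union_of_disjoint, Finset.card_union_of_disjoint]
  · have h1 : ((({p} : Finset P) ×ˢ T).filter fun a => c a.1 = c a.2).card =
        (T.filter fun q => c q = c p).card := by
      symm
      apply Finset.card_bij (fun q _ => (p, q))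
      · intro q hq
        simp only [Finset.mem_filter, Finset.mem_product, Finset.mem_singleton] at hq ⊢
        exact ⟨⟨by simp, hq.1⟩, hq.2.symm⟩
      · intro a _ b _ h
        exact (Prod.mk.inj h).2
      · rintro ⟨a, b⟩ h
        simp only [Finset.mem_filter, Finset.mem_product, Finset.mem_singleton] at h
        obtain ⟨⟨rfl, h1⟩, h2⟩ := h
        exact ⟨b, by simp [h1, h2], rfl⟩
    have h2 : ((T ×ˢ ({p} : Finset P)).filter fun a => c a.1 = c a.2).card =
        (T.filter fun q => c q = c p).card := by
      symm
      apply Finset.card_bij (fun q _ => (q, p))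
      · intro q hq
        simp only [Finset.mem_filter, Finset.mem_product, Finset.mem_singleton] at hq ⊢
        exact ⟨⟨hq.1, by simp⟩, hq.2⟩
      · intro a _ b _ h
        exact (Prod.mk.inj h).1
      · rintro ⟨a, b⟩ h
        simp only [Finset.mem_filter, Finset.mem_product, Finset.mem_singleton] at h
        obtain ⟨⟨h1, rfl⟩, h2⟩ := h
        exact ⟨a, Finset.mem_filter.2 ⟨by assumption, h2⟩, rfl⟩
    omega
  · rw [Finset.disjoint_left]
    rintro ⟨a, b⟩ h h'
    simp only [Finset.mem_filter, Finset.mem_product, Finset.mem_singleton,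
      Finset.mem_offDiag] at h h'
    exact hp (h'.1.1 ▸ h.1.1)
  · rw [Finset.disjoint_left]
    rintro ⟨a, b⟩ h h'
    simp only [Finset.mem_filter, Finset.mem_product, Finset.mem_singleton, Finset.mem_union,
      Finset.mem_offDiag] at h h'
    rcases h with h | h
    · exact hp (h'.1.2 ▸ h.1.2.1)
    · exact hp (h'.1.2 ▸ h.1.2)

lemma SS_asymp {c : P → ι} {K : ℕ} (hK : ∀ i, (Finset.univ.filter fun x => c x = i).card ≤ K)
    (hK1 : 1 ≤ K) (hR : 1 ≤ Fintype.card R)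
    (hM : 16 * Fintype.card R * K ≤ Fintype.card P)
    (hJ : Fintype.card J * Fintype.card R = Fintype.card P) (T : Finset P) :
    0 < (SS c T (J := J) (R := R)).card ∧
    |Real.log (SS c T (J := J) (R := R)).card - Real.log (Nat.factorial (Fintype.card P)) +
      (e2 c T : ℝ) * ((Fintype.card R : ℝ) - 1) / (2 * Fintype.card P)| ≤
      13 * (Fintype.card R : ℝ) ^ 2 * (e2 c T : ℝ) * K / (Fintype.card P : ℝ) ^ 2 := by
  have hRK : 1 ≤ Fintype.card R * K := Nat.mul_pos hR hK1
  have hM' : 4 * Fintype.card R * K + 12 ≤ Fintype.card P := by nlinarith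
  induction T using Finset.induction_on with
  | empty =>
    have h0 : (SS c ∅ (J := J) (R := R)).card = Nat.factorial (Fintype.card P) := by
      have : SS c ∅ (J := J) (R := R) = Finset.univ := by
        ext σ; simp [mem_SS]
      rw [this, Finset.card_univ]
      have hc : Fintype.card P = Fintype.card (J × R) := by rw [Fintype.card_prod, hJ]
      exact Fintype.card_equiv (Fintype.equivOfCardEq hc)
    rw [h0]
    refine ⟨Nat.factorial_pos _, ?_⟩
    simp [e2]
  | insert p T hp ih =>
    obtain ⟨ih1, ih2⟩ := ih
    have a1 := card_split (J := J) (R := R) c hp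
    have a2 := upperB (J := J) (R := R) hK hp
    have a3 := lowerB (J := J) (R := R) (c := c) hp
    have a4 := W_bound (J := J) (R := R) hK hp hM' hJ
    have a5 : (QQ c T p).card ≤ K := (Finset.card_le_card (by
      intro x hx
      simp only [QQ, Finset.mem_filter, Finset.mem_univ, true_and] at hx ⊢
      exact hx.2)).trans (hK (c p))
    have hP : 0 < Fintype.card P := by omega
    have a4' : (∑ σ ∈ SS c (insert p T) (J := J) (R := R), (Ys c T p σ).card) * Fintype.card P ≤
      16 * (QQ c T p).card * K * Fintype.card R ^ 2 * (SS c T (J := J) (R := R)).card := by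
      apply Nat.le_of_mul_le_mul_right _ (pow_pos hP 3)
      calc _ = _ := by ring
        _ ≤ _ := a4
        _ = _ := by ring
    generalize (∑ σ ∈ SS c (insert p T) (J := J) (R := R), (Ys c T p σ).card) = W at a3 a4'
    have hcast : ((Fintype.card R - 1 : ℕ) : ℝ) = (Fintype.card R : ℝ) - 1 := by
      rw [Nat.cast_sub hR]; simp
    have b2 := (Nat.cast_le (α := ℝ)).2 a2
    have b3 := (Nat.cast_le (α := ℝ)).2 a3
    have b4 := (Nat.cast_le (α := ℝ)).2 a4'
    push_cast [hcast] at b2 b3 b4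
    have := real_step (Fintype.card P) K (QQ c T p).card (Fintype.card R)
      (SS c T (J := J) (R := R)).card (BB c T p (J := J) (R := R)).card
      (SS c (insert p T) (J := J) (R := R)).card W (by exact_mod_cast a1) (by positivity)
      b2 b3 b4 (by positivity) (by exact_mod_cast a5) (by exact_mod_cast hM)
      (by exact_mod_cast hP) (by exact_mod_cast hR) (by exact_mod_cast ih1)
    obtain ⟨c1, c2⟩ := this
    refine ⟨by exact_mod_cast c1, ?_⟩
    rw [e2_insert c hp]
    have := (abs_add_le _ _).trans (add_le_add ih2 c2)
    have hP0 : (Fintype.card P : ℝ) ≠ 0 := by positivity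
    refine le_trans (le_of_eq ?_) (this.trans (le_of_eq ?_))
    · congr 1
      push_cast
      field_simp
      ring
    · push_cast
      ring

/-- repeated rows -/
noncomputable def RepS (c : P → ι) : Finset (P ≃ J × R) :=
  (SS c Finset.univ).filter fun σ => ∃ j1 j2, j1 ≠ j2 ∧
    ∀ b, ∃ b', c (σ.symm (j1, b)) = c (σ.symm (j2, b'))

lemma RepS_sub (c : P → ι) : RepS c (J := J) (R := R) ⊆ SS c Finset.univ :=
  Finset.filter_subset _ _

lemma Rep_bound {c : P → ι} {K : ℕ} (hK : ∀ i, (Finset.univ.filter fun x => c x = i).card ≤ K)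
    (hK1 : 1 ≤ K) (hR : 3 ≤ Fintype.card R)
    (hM : 16 * Fintype.card R * K ≤ Fintype.card P)
    (hJ : Fintype.card J * Fintype.card R = Fintype.card P) :
    (RepS c (J := J) (R := R)).card * Fintype.card P ≤
      64 * Fintype.card R * K ^ 3 * (SS c Finset.univ (J := J) (R := R)).card := by
  have hRK : 3 ≤ Fintype.card R * K := by nlinarith
  have hM' : 4 * Fintype.card R * K + 12 ≤ Fintype.card P := by nlinarith
  have hP : 0 < Fintype.card P := by omega
  obtain ⟨g⟩ : Nonempty (Fin 3 ↪ R) := by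
    apply Function.Embedding.nonempty_of_card_le
    simpa using hR
  let Ω : Finset ((P ≃ J × R) × (Fin 3 → P × P) × J × J × (Fin 3 → R)) :=
    Finset.univ.filter fun a => a.1 ∈ SS c Finset.univ ∧
      a.2.2.1 ≠ a.2.2.2.1 ∧
      (∀ i, c (a.2.1 i).1 = c (a.2.1 i).2) ∧
      (∀ i, a.1 (a.2.1 i).1 = (a.2.2.1, g i)) ∧
      (∀ i, a.1 (a.2.1 i).2 = (a.2.2.2.1, a.2.2.2.2 i))
  have hW : (RepS c (J := J) (R := R)).card ≤ Ω.card := by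
    have : RepS c (J := J) (R := R) ⊆ Ω.image fun a => a.1 := by
      intro σ h
      simp only [RepS, Finset.mem_filter] at h
      obtain ⟨h1, j1, j2, hj, h2⟩ := h
      choose b' hb' using h2
      refine Finset.mem_image.2 ⟨(σ, fun i => (σ.symm (j1, g i), σ.symm (j2, b' (g i))), j1, j2,
        fun i => b' (g i)), ?_, rfl⟩
      simp only [Ω, Finset.mem_filter, Finset.mem_univ, true_and]
      refine ⟨h1, hj, fun i => hb' _, fun i => by simp, fun i => by simp⟩
    exact (Finset.card_le_card this).trans Finset.card_image_le
  let t : Finset ((Fin 3 → P × P) × J × J × (Fin 3 → R)) :=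
    (Fintype.piFinset fun _ => (Finset.univ : Finset (P × P)).filter fun a => c a.1 = c a.2) ×ˢ
      Finset.univ
  have hf : ∀ a ∈ Ω, a.2 ∈ t := by
    rintro ⟨σ, pq, j1, j2, b⟩ h
    simp only [Ω, Finset.mem_filter, Finset.mem_univ, true_and] at h
    simp [t, h.2.2.1]
  have hfib : ∀ b ∈ t, (Ω.filter fun a => a.2 = b).card * Fintype.card P ^ 6 ≤
      64 * (SS c Finset.univ (J := J) (R := R)).card := by
    rintro ⟨pq, j1, j2, b⟩ hb
    by_cases hne : (Ω.filter fun a => a.2 = (pq, j1, j2, b)).Nonempty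
    · obtain ⟨⟨σ, pq', j1', j2', b'⟩, h⟩ := hne
      simp only [Ω, Finset.mem_filter, Finset.mem_univ, true_and, Prod.mk.injEq] at h
      obtain ⟨⟨h1, h2, h3, h4, h5⟩, rfl, rfl, rfl, rfl⟩ := h
      have hpp : ∀ i i', i ≠ i' → (pq' i).1 ≠ (pq' i').1 := by
        intro i i' hi e
        have := h4 i
        rw [e, h4 i'] at this
        exact hi (g.injective (Prod.mk.inj this).2.symm)
      have hpq : ∀ i i', (pq' i).1 ≠ (pq' i').2 := by
        intro i i' e
        have := h4 i
        rw [e, h5 i'] at this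
        exact h2 (Prod.mk.inj this).1.symm
      have hqq : ∀ i i', i ≠ i' → (pq' i).2 ≠ (pq' i').2 := by
        intro i i' hi e
        have hc : c (pq' i).1 = c (pq' i').1 := by rw [h3, h3, e]
        refine mem_SS.1 h1 _ (Finset.mem_univ _) _ (Finset.mem_univ _) (hpp i i' hi) hc ?_
        rw [h4, h4]
      have hX := XX_bound (J := J) (R := R) c K hK Finset.univ hM'
        [((pq' 0).1, (j1', g 0)), ((pq' 1).1, (j1', g 1)), ((pq' 2).1, (j1', g 2)),
         ((pq' 0).2, (j2', b' 0)), ((pq' 1).2, (j2', b' 1)), ((pq' 2).2, (j2', b' 2))]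
        (by simp [hpp, hpq, hqq]) (by simp)
      simp only [List.length_cons, List.length_nil, zero_add, Nat.reduceAdd] at hX
      norm_num at hX
      refine le_trans (Nat.mul_le_mul_right _ ?_) hX
      apply Finset.card_le_card_of_injOn (fun a => a.1)
      · rintro ⟨σ, q', x', y'⟩ h
        simp only [Ω, Finset.coe_filter, Set.mem_ofPred_eq, Finset.mem_filter, Finset.mem_univ,
          true_and, Prod.mk.injEq] at h
        obtain ⟨⟨g1, g2, g3, g4, g5⟩, rfl, rfl, rfl⟩ := h
        simp only [XX, Finset.coe_filter, Set.mem_ofPred_eq]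
        refine ⟨g1, ?_⟩
        simp only [List.mem_cons, List.not_mem_nil, or_false, forall_eq_or_imp, forall_eq]
        exact ⟨g4 0, g4 1, g4 2, g5 0, g5 1, g5 2⟩
      · rintro ⟨σ, q'⟩ h ⟨σ', q''⟩ h' heq
        simp only [Finset.coe_filter, Set.mem_ofPred_eq] at h h' heq
        rw [heq, h.2, h'.2]
    · rw [Finset.not_nonempty_iff_eq_empty] at hne
      rw [hne]; simp
  have htot : Ω.card * Fintype.card P ^ 6 ≤
      t.card * (64 * (SS c Finset.univ (J := J) (R := R)).card) := by
    rw [Finset.card_eq_sum_card_fiberwise hf, Finset.sum_mul]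
    refine (Finset.sum_le_sum hfib).trans ?_
    simp
  have ht : t.card ≤ (Fintype.card P * K) ^ 3 *
      (Fintype.card J * (Fintype.card J * Fintype.card R ^ 3)) := by
    simp only [t, Finset.card_product, Finset.card_univ, Fintype.card_prod, Fintype.card_piFinset,
      Finset.prod_const, Fintype.card_fin, Fintype.card_fun]
    have := card_pairs c K hK
    gcongr
  apply Nat.le_of_mul_le_mul_right _ (pow_pos hP 5)
  calc _ = (RepS c (J := J) (R := R)).card * Fintype.card P ^ 6 := by ring
    _ ≤ Ω.card * Fintype.card P ^ 6 := Nat.mul_le_mul_right _ hW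
    _ ≤ _ := htot
    _ ≤ _ := Nat.mul_le_mul_right _ ht
    _ = 64 * Fintype.card R * K ^ 3 * (SS c Finset.univ (J := J) (R := R)).card *
        (Fintype.card P ^ 3 * (Fintype.card J * Fintype.card R) ^ 2) := by ring
    _ = _ := by rw [hJ]; ring

end Generic3

section Corr
variable {n : ℕ} (k : Fin n → ℕ) (r m : ℕ)

noncomputable def AA : Finset (Fin m → Finset (Fin n)) :=
  Finset.univ.filter fun e => Function.Injective e ∧ (∀ j, (e j).card = r) ∧
    ∀ i, (Finset.univ.filter fun j => i ∈ e j).card = k i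

noncomputable def HH : Finset (Finset (Finset (Fin n))) :=
  Finset.univ.filter fun E =>
    (∀ e ∈ E, e.card = r) ∧ ∀ i, (E.filter fun e => i ∈ e).card = k i

lemma Hcount_eq : Hcount r k = (HH k r).card := by
  unfold Hcount HH
  rw [← Set.ncard_coe_finset]
  congr 1
  ext E
  simp

lemma HH_card {E : Finset (Finset (Fin n))} (hE : E ∈ HH k r) (hm : m * r = Mtot k)
    (hr : 0 < r) : E.card = m := by
  simp only [HH, Finset.mem_filter, Finset.mem_univ, true_and] at hE
  have h := Finset.sum_card_bipartiteAbove_eq_sum_card_bipartiteBelow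
    (s := (Finset.univ : Finset (Fin n))) (t := E) (fun i e => i ∈ e)
  have h1 : ∑ i, (E.bipartiteAbove (fun i e => i ∈ e) i).card = Mtot k :=
    Finset.sum_congr rfl fun i _ => hE.2 i
  have h2 : ∑ e ∈ E, ((Finset.univ : Finset (Fin n)).bipartiteBelow (fun i e => i ∈ e) e).card
      = E.card * r := by
    rw [Finset.sum_const_nat]
    intro e he
    rw [← hE.1 e he]
    congr 1
    ext i
    simp [Finset.bipartiteBelow]
  rw [h1, h2, ← hm] at h
  exact (Nat.eq_of_mul_eq_mul_right hr h).symm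

lemma AA_image {e : Fin m → Finset (Fin n)} (he : e ∈ AA k r m) :
    Finset.univ.image e ∈ HH k r := by
  simp only [AA, HH, Finset.mem_filter, Finset.mem_univ, true_and] at he ⊢
  refine ⟨?_, ?_⟩
  · intro x hx
    obtain ⟨j, -, rfl⟩ := Finset.mem_image.1 hx
    exact he.2.1 j
  · intro i
    rw [Finset.filter_image, Finset.card_image_of_injective _ he.1]
    exact he.2.2 i

lemma AA_fiber {E : Finset (Finset (Fin n))} (hE : E ∈ HH k r) (hm : m * r = Mtot k)
    (hr : 0 < r) :
    ((AA k r m).filter fun e => Finset.univ.image e = E).card = Nat.factorial m := by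
  have hc := HH_card k r m hE hm hr
  have h1 : Fintype.card (Fin m ≃ {x // x ∈ E}) = Nat.factorial m := by
    rw [Fintype.card_equiv (Fintype.equivOfCardEq (by simp [hc])), Fintype.card_fin]
  rw [← h1, ← Finset.card_univ]
  symm
  apply Finset.card_bij (fun (τ : Fin m ≃ {x // x ∈ E}) _ => fun j => (τ j).1)
  · intro τ _
    have him : Finset.univ.image (fun j => (τ j).1) = E := by
      ext x
      simp only [Finset.mem_image, Finset.mem_univ, true_and]
      constructor
      · rintro ⟨j, rfl⟩; exact (τ j).2
      · intro hx; exact ⟨τ.symm ⟨x, hx⟩, by simp⟩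
    have hinj : Function.Injective (fun j => (τ j).1) :=
      Subtype.val_injective.comp τ.injective
    simp only [AA, HH, Finset.mem_filter, Finset.mem_univ, true_and] at hE ⊢
    refine ⟨⟨hinj, fun j => hE.1 _ (τ j).2, ?_⟩, him⟩
    intro i
    rw [← hE.2 i, ← Finset.card_image_of_injective _ hinj]
    conv_rhs => rw [← him, Finset.filter_image]
  · intro τ _ τ' _ h
    ext1 j
    exact Subtype.ext (congrFun h j)
  · intro e he
    simp only [AA, Finset.mem_filter, Finset.mem_univ, true_and] at he
    obtain ⟨⟨h1, h2, h3⟩, h4⟩ := he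
    have hmem : ∀ j, e j ∈ E := fun j => h4 ▸ Finset.mem_image_of_mem e (Finset.mem_univ j)
    refine ⟨Equiv.ofBijective (fun j => ⟨e j, hmem j⟩) ⟨?_, ?_⟩, Finset.mem_univ _, ?_⟩
    · intro a b hab
      exact h1 (Subtype.mk.inj hab)
    · rintro ⟨x, hx⟩
      rw [← h4] at hx
      obtain ⟨j, -, hj⟩ := Finset.mem_image.1 hx
      exact ⟨j, Subtype.ext hj⟩
    · rfl

lemma AA_card (hm : m * r = Mtot k) (hr : 0 < r) :
    (AA k r m).card = Hcount r k * Nat.factorial m := by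
  rw [Hcount_eq, Finset.card_eq_sum_card_fiberwise (t := HH k r)
    (f := fun e => Finset.univ.image e) (fun e he => AA_image k r m he)]
  rw [Finset.sum_const_nat]
  intro E hE
  exact AA_fiber k r m hE hm hr

/-- placements compatible with a given row assignment -/
noncomputable def Fib (e : Fin m → Finset (Fin n)) : Finset (Pts k ≃ Fin m × Fin r) :=
  (SS (fun p : Pts k => p.1) Finset.univ).filter fun σ => ∀ p, p.1 ∈ e (σ p).1

lemma Fib_card {e : Fin m → Finset (Fin n)} (he : e ∈ AA k r m) (hm : m * r = Mtot k) :
    (Fib k r m e).card = Nat.factorial r ^ m * ∏ i, Nat.factorial (k i) := by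
  simp only [AA, Finset.mem_filter, Finset.mem_univ, true_and] at he
  obtain ⟨he1, he2, he3⟩ := he
  have c1 : ∀ i, Fintype.card {j // i ∈ e j} = k i := by
    intro i
    rw [Fintype.card_subtype, he3]
  have c2 : ∀ j, Fintype.card {i // i ∈ e j} = r := by
    intro j
    rw [Fintype.card_coe, he2]
  have h1 : Fintype.card ((∀ i, Fin (k i) ≃ {j // i ∈ e j}) × (∀ j, {i // i ∈ e j} ≃ Fin r)) =
      Nat.factorial r ^ m * ∏ i, Nat.factorial (k i) := by
    rw [Fintype.card_prod, Fintype.card_pi, Fintype.card_pi, mul_comm]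
    congr 1
    · rw [Finset.prod_congr rfl (g := fun _ => Nat.factorial r)]
      · simp
      · intro j _
        rw [Fintype.card_equiv (Fintype.equivOfCardEq (by simp [he2])), c2]
    · apply Finset.prod_congr rfl
      intro i _
      rw [Fintype.card_equiv (Fintype.equivOfCardEq (by rw [c1, Fintype.card_fin])),
        Fintype.card_fin]
  rw [← h1, ← Finset.card_univ]
  symm
  let F : ((∀ i, Fin (k i) ≃ {j // i ∈ e j}) × (∀ j, {i // i ∈ e j} ≃ Fin r)) →
      Pts k → Fin m × Fin r := fun a p =>
    ((a.1 p.1 p.2).1, a.2 (a.1 p.1 p.2).1 ⟨p.1, (a.1 p.1 p.2).2⟩)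
  have aux : ∀ (β : ∀ j, {i // i ∈ e j} ≃ Fin r) (i i' : Fin n) (a : {j // i ∈ e j})
      (a' : {j // i' ∈ e j}), a.1 = a'.1 → β a.1 ⟨i, a.2⟩ = β a'.1 ⟨i', a'.2⟩ → i = i' := by
    rintro β i i' ⟨j, hj⟩ ⟨j', hj'⟩ h h'
    dsimp only at h h'
    subst h
    have := (β j).injective h'
    exact Subtype.mk.inj this
  have hcard : Fintype.card (Pts k) = Fintype.card (Fin m × Fin r) := by
    simp [Pts, hm, Mtot]
  have hinj : ∀ a, Function.Injective (F a) := by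
    rintro ⟨α, β⟩ ⟨i, t⟩ ⟨i', t'⟩ h
    simp only [F, Prod.mk.injEq] at h
    have := aux β i i' _ _ h.1 h.2
    subst this
    have := (α i).injective (Subtype.ext h.1)
    rw [this]
  have hbij : ∀ a, Function.Bijective (F a) := fun a =>
    (Fintype.bijective_iff_injective_and_card _).2 ⟨hinj a, hcard⟩
  apply Finset.card_bij (fun a _ => Equiv.ofBijective (F a) (hbij a))
  · rintro ⟨α, β⟩ _
    simp only [Fib, Finset.mem_filter, mem_SS]
    refine ⟨?_, ?_⟩
    · rintro ⟨i, t⟩ _ ⟨i', t'⟩ _ hne hc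
      dsimp only at hc
      subst hc
      simp only [Equiv.ofBijective_apply, F]
      intro h
      exact hne (by rw [(α i).injective (Subtype.ext h)])
    · intro p
      exact (α p.1 p.2).2
  · rintro ⟨α, β⟩ _ ⟨α', β'⟩ _ h
    have hF : ∀ p, F (α, β) p = F (α', β') p := fun p => by
      have := congrArg (fun f => f p) h
      simpa using this
    have hα : α = α' := by
      funext i
      ext1 t
      exact Subtype.ext (congrArg Prod.fst (hF ⟨i, t⟩))
    subst hα
    congr 1
    funext j
    ext1 ⟨i, hi⟩
    have := congrArg Prod.snd (hF ⟨i, (α i).symm ⟨j, hi⟩⟩)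
    simp only [F] at this
    have key : ∀ (a : {j // i ∈ e j}), β a.1 ⟨i, a.2⟩ = β' a.1 ⟨i, a.2⟩ → a = ⟨j, hi⟩ →
        β j ⟨i, hi⟩ = β' j ⟨i, hi⟩ := by
      rintro a h rfl; exact h
    exact key _ this (by simp)
  · intro σ hσ
    simp only [Fib, Finset.mem_filter, mem_SS] at hσ
    obtain ⟨hσ1, hσ2⟩ := hσ
    let α : ∀ i, Fin (k i) ≃ {j // i ∈ e j} := fun i =>
      Equiv.ofBijective (fun t => ⟨(σ ⟨i, t⟩).1, hσ2 ⟨i, t⟩⟩)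
        ((Fintype.bijective_iff_injective_and_card _).2 ⟨by
          intro t t' h
          by_contra hne
          refine hσ1 ⟨i, t⟩ (Finset.mem_univ _) ⟨i, t'⟩ (Finset.mem_univ _) ?_ rfl
            (Subtype.mk.inj h)
          intro h'
          exact hne (by simpa using h'), by rw [c1, Fintype.card_fin]⟩)
    have hα : ∀ i j hj, (σ ⟨i, (α i).symm ⟨j, hj⟩⟩).1 = j := by
      intro i j hj
      have : α i ((α i).symm ⟨j, hj⟩) = ⟨j, hj⟩ := by simp
      exact congrArg Subtype.val this
    let β : ∀ j, {i // i ∈ e j} ≃ Fin r := fun j =>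
      Equiv.ofBijective (fun i => (σ ⟨i.1, (α i.1).symm ⟨j, i.2⟩⟩).2)
        ((Fintype.bijective_iff_injective_and_card _).2 ⟨by
          rintro ⟨i, hi⟩ ⟨i', hi'⟩ h
          have := σ.injective (Prod.ext ((hα i j hi).trans (hα i' j hi').symm) h)
          exact Subtype.ext (Sigma.mk.inj this).1, by rw [c2, Fintype.card_fin]⟩)
    refine ⟨(α, β), Finset.mem_univ _, ?_⟩
    ext1 ⟨i, t⟩
    apply Prod.ext
    · rfl
    · change (σ ⟨i, (α i).symm ⟨(α i t).1, (α i t).2⟩⟩).2 = (σ ⟨i, t⟩).2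
      simp

noncomputable def rows (σ : Pts k ≃ Fin m × Fin r) (j : Fin m) : Finset (Fin n) :=
  Finset.univ.image fun b => (σ.symm (j, b)).1

noncomputable def GoodS : Finset (Pts k ≃ Fin m × Fin r) :=
  (SS (fun p : Pts k => p.1) Finset.univ).filter fun σ => σ ∉ RepS (fun p : Pts k => p.1)

lemma SS_inj {σ : Pts k ≃ Fin m × Fin r} (h : σ ∈ SS (fun p : Pts k => p.1) Finset.univ)
    (j : Fin m) : Function.Injective fun b => (σ.symm (j, b)).1 := by
  intro b b' hb
  by_contra hne
  refine mem_SS.1 h (σ.symm (j, b)) (Finset.mem_univ _) (σ.symm (j, b')) (Finset.mem_univ _) ?_ hb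
    (by simp)
  intro h'
  exact hne (by simpa using h')

lemma rows_card {σ : Pts k ≃ Fin m × Fin r} (h : σ ∈ SS (fun p : Pts k => p.1) Finset.univ)
    (j : Fin m) : (rows k r m σ j).card = r := by
  rw [rows, Finset.card_image_of_injective _ (SS_inj k r m h j)]
  simp

lemma rows_mem {σ : Pts k ≃ Fin m × Fin r} (h : σ ∈ GoodS k r m) : rows k r m σ ∈ AA k r m := by
  simp only [GoodS, Finset.mem_filter] at h
  obtain ⟨h1, h2⟩ := h
  simp only [AA, Finset.mem_filter, Finset.mem_univ, true_and]
  refine ⟨?_, rows_card k r m h1, ?_⟩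
  · intro j1 j2 hj
    by_contra hne
    apply h2
    simp only [RepS, Finset.mem_filter]
    refine ⟨h1, j1, j2, hne, ?_⟩
    intro b
    have hm : (σ.symm (j1, b)).1 ∈ rows k r m σ j1 :=
      Finset.mem_image_of_mem _ (Finset.mem_univ b)
    rw [hj] at hm
    obtain ⟨b', -, hb'⟩ := Finset.mem_image.1 hm
    exact ⟨b', hb'.symm⟩
  · intro i
    rw [← Fintype.card_fin (k i), ← Finset.card_univ]
    symm
    apply Finset.card_bij (fun t _ => (σ ⟨i, t⟩).1)
    · intro t _
      simp only [Finset.mem_filter, Finset.mem_univ, true_and, rows, Finset.mem_image]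
      exact ⟨(σ ⟨i, t⟩).2, by simp⟩
    · intro t _ t' _ h
      by_contra hne
      refine mem_SS.1 h1 ⟨i, t⟩ (Finset.mem_univ _) ⟨i, t'⟩ (Finset.mem_univ _) ?_ rfl h
      intro h'
      exact hne (by simpa using h')
    · intro j hj
      simp only [Finset.mem_filter, Finset.mem_univ, true_and, rows, Finset.mem_image] at hj
      obtain ⟨b, hb⟩ := hj
      generalize hp : σ.symm (j, b) = p at hb
      obtain ⟨i', t⟩ := p
      dsimp only at hb
      subst hb
      refine ⟨t, Finset.mem_univ _, ?_⟩
      rw [← hp]; simp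

lemma Fib_eq {e : Fin m → Finset (Fin n)} (he : e ∈ AA k r m) :
    ((GoodS k r m).filter fun σ => rows k r m σ = e) = Fib k r m e := by
  ext σ
  simp only [AA, Finset.mem_filter, Finset.mem_univ, true_and] at he
  simp only [Fib, GoodS, Finset.mem_filter]
  constructor
  · rintro ⟨⟨h1, h2⟩, rfl⟩
    refine ⟨h1, fun p => ?_⟩
    exact Finset.mem_image.2 ⟨(σ p).2, Finset.mem_univ _, by simp⟩
  · rintro ⟨h1, h2⟩
    have hrows : rows k r m σ = e := by
      funext j
      apply Finset.eq_of_subset_of_card_le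
      · intro i hi
        obtain ⟨b, -, rfl⟩ := Finset.mem_image.1 hi
        have := h2 (σ.symm (j, b))
        simpa using this
      · rw [he.2.1, rows_card k r m h1]
    refine ⟨⟨h1, ?_⟩, hrows⟩
    intro hrep
    simp only [RepS, Finset.mem_filter] at hrep
    obtain ⟨-, j1, j2, hne, hb⟩ := hrep
    apply hne
    apply he.1
    rw [← hrows]
    apply Finset.eq_of_subset_of_card_le
    · intro i hi
      obtain ⟨b, -, rfl⟩ := Finset.mem_image.1 hi
      obtain ⟨b', hb'⟩ := hb b
      exact Finset.mem_image.2 ⟨b', Finset.mem_univ _, hb'.symm⟩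
    · rw [rows_card k r m h1, rows_card k r m h1]

lemma GoodS_card (hm : m * r = Mtot k) (hr : 0 < r) :
    (GoodS k r m).card = Hcount r k * Nat.factorial m *
      (Nat.factorial r ^ m * ∏ i, Nat.factorial (k i)) := by
  rw [← AA_card k r m hm hr, Finset.card_eq_sum_card_fiberwise (t := AA k r m)
    (f := rows k r m) (fun σ h => rows_mem k r m h)]
  rw [Finset.sum_const_nat]
  intro e he
  rw [Fib_eq k r m he, Fib_card k r m he hm]

lemma GoodS_add : (GoodS k r m).card + (RepS (fun p : Pts k => p.1) (J := Fin m) (R := Fin r)).card =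
    (SS (fun p : Pts k => p.1) Finset.univ (J := Fin m) (R := Fin r)).card := by
  rw [← Finset.card_filter_add_card_filter_not (s := SS (fun p : Pts k => p.1) Finset.univ (J := Fin m) (R := Fin r))
    (fun σ => σ ∉ RepS (fun p : Pts k => p.1))]
  unfold GoodS
  congr 2
  ext σ
  simp only [not_not, Finset.mem_filter]
  constructor
  · intro h; exact ⟨RepS_sub _ h, h⟩
  · exact fun h => h.2

lemma e2_univ : e2 (fun p : Pts k => p.1) Finset.univ = M2 k := by
  unfold e2 M2
  have h : ((Finset.univ : Finset (Pts k)).offDiag.filter fun a => a.1.1 = a.2.1).card =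
    ((Finset.univ : Finset (Fin n)).sigma fun i => (Finset.univ : Finset (Fin (k i))).offDiag).card := by
    symm
    apply Finset.card_bij (fun a _ => (⟨a.1, a.2.1⟩, ⟨a.1, a.2.2⟩))
    · rintro ⟨i, t, t'⟩ h
      simp at h ⊢
      exact h
    · rintro ⟨i, t, t'⟩ h ⟨i', s, s'⟩ h' heq
      simp only [Prod.mk.injEq, Sigma.mk.injEq] at heq
      obtain ⟨⟨rfl, h1⟩, -, h2⟩ := heq
      rw [eq_of_heq h1, eq_of_heq h2]
    · rintro ⟨⟨i, t⟩, ⟨i', t'⟩⟩ h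
      simp only [Finset.mem_filter, Finset.mem_offDiag, Finset.mem_univ, true_and] at h
      obtain ⟨h1, rfl⟩ := h
      refine ⟨⟨i, t, t'⟩, ?_, rfl⟩
      simpa using h1
  refine Eq.trans (by congr) (h.trans ?_)
  rw [Finset.card_sigma]
  apply Finset.sum_congr rfl
  intro i _
  rw [Finset.offDiag_card, Finset.card_univ, Fintype.card_fin, Nat.mul_sub, mul_one]

lemma cell_card (i : Fin n) :
    ((Finset.univ : Finset (Pts k)).filter fun p => p.1 = i).card ≤ kmax k := by
  refine le_trans ?_ (Finset.le_sup (f := k) (Finset.mem_univ i))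
  have : ((Finset.univ : Finset (Pts k)).filter fun p => p.1 = i) ⊆
      (Finset.univ : Finset (Fin (k i))).image fun t => (⟨i, t⟩ : Pts k) := by
    rintro ⟨i', t⟩ h
    simp only [Finset.mem_filter, Finset.mem_univ, true_and] at h
    subst h
    exact Finset.mem_image_of_mem _ (Finset.mem_univ _)
  refine (Finset.card_le_card this).trans (Finset.card_image_le.trans ?_)
  simp

end Corr

lemma M2_le {n : ℕ} (k : Fin n → ℕ) : M2 k ≤ kmax k * Mtot k := by
  unfold M2 Mtot
  rw [Finset.mul_sum]
  apply Finset.sum_le_sum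
  intro i _
  rw [mul_comm]
  exact Nat.mul_le_mul_right _ ((Nat.sub_le _ _).trans (Finset.le_sup (f := k) (Finset.mem_univ i)))

lemma real_final (M K r S G Rp m2 L : ℝ) (hM : 0 < M) (hK : 1 ≤ K) (hr : 1 ≤ r)
    (hS : 0 < S) (hG : G + Rp = S) (hRp : 0 ≤ Rp) (hR : Rp * M ≤ 64 * r * K ^ 3 * S)
    (hδ : K ^ 3 ≤ 1 / (128 * r) * M) (hm2 : 0 ≤ m2) (hm2' : m2 ≤ K * M)
    (hA : |Real.log S - L + m2 * (r - 1) / (2 * M)| ≤ 13 * r ^ 2 * m2 * K / M ^ 2) :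
    0 < G ∧ |Real.log G - L + m2 * (r - 1) / (2 * M)| ≤ (13 * r ^ 2 + 128 * r) * K ^ 3 / M := by
  obtain ⟨ρ, rfl⟩ : ∃ ρ, Rp = ρ * S := ⟨Rp / S, by field_simp⟩
  have hGe : G = (1 - ρ) * S := by linarith
  subst hGe
  have hρ : 0 ≤ ρ := nonneg_of_mul_nonneg_left hRp hS
  have hρM : ρ * M ≤ 64 * r * K ^ 3 := by
    apply le_of_mul_le_mul_right _ hS; nlinarith
  have hδ' : 128 * r * K ^ 3 ≤ M := by
    have : 1 / (128 * r) * M = M / (128 * r) := by ring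
    rw [this, le_div_iff₀ (by positivity)] at hδ
    linarith
  have hρ2 : ρ ≤ 1 / 2 := by
    by_contra h
    push Not at h
    nlinarith
  have hpos : 0 < 1 - ρ := by linarith
  refine ⟨by positivity, ?_⟩
  rw [Real.log_mul hpos.ne' hS.ne']
  have hlog1 := Real.log_le_sub_one_of_pos hpos
  have hlog2 := Real.one_sub_inv_le_log_of_pos hpos
  have hlog3 : -(2 * ρ) ≤ 1 - (1 - ρ)⁻¹ := by
    rw [← sub_nonneg]
    have : 1 - (1 - ρ)⁻¹ - -(2 * ρ) = ρ * (1 - 2 * ρ) / (1 - ρ) := by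
      field_simp; ring
    rw [this]
    exact div_nonneg (mul_nonneg hρ (by linarith)) hpos.le
  have hl : |Real.log (1 - ρ)| ≤ 128 * r * K ^ 3 / M := by
    have : 2 * ρ ≤ 128 * r * K ^ 3 / M := by
      rw [le_div_iff₀ hM]; linarith
    rw [abs_le]
    constructor <;> linarith
  have hA2 : 13 * r ^ 2 * m2 * K / M ^ 2 ≤ 13 * r ^ 2 * K ^ 3 / M := by
    rw [div_le_div_iff₀ (by positivity) hM]
    have h1 : m2 * K ≤ K ^ 3 * M := by
      have h2 : m2 * K ≤ K * M * K := mul_le_mul_of_nonneg_right hm2' (by linarith)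
      have h3 : K * M * K ≤ K * M * K * K := le_mul_of_one_le_right (by positivity) hK
      nlinarith
    have h4 := mul_le_mul_of_nonneg_left h1 (by positivity : 0 ≤ 13 * r ^ 2 * M)
    nlinarith
  have e1 : Real.log (1 - ρ) + Real.log S - L + m2 * (r - 1) / (2 * M) =
      Real.log (1 - ρ) + (Real.log S - L + m2 * (r - 1) / (2 * M)) := by ring
  rw [e1]
  refine (abs_add_le _ _).trans ((add_le_add hl (hA.trans hA2)).trans (le_of_eq ?_))
  ring

/-- asymptotic enumeration of simple r-uniform hypergraphs with
degree sequence k (Theorem 1 of the paper). -/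
theorem hypergraph_enumeration (r : ℕ) (hr : 3 ≤ r) :
    ∃ C δ : ℝ, 0 < C ∧ 0 < δ ∧
      ∀ (n : ℕ) (k : Fin n → ℕ),
        r ∣ Mtot k → 2 ≤ kmax k → (kmax k : ℝ) ^ 3 ≤ δ * (Mtot k : ℝ) →
        ∃ E : ℝ, |E| ≤ C * (kmax k : ℝ) ^ 3 / (Mtot k : ℝ) ∧
          (Hcount r k : ℝ) =
            (Nat.factorial (Mtot k) : ℝ) /
                ((Nat.factorial (Mtot k / r) : ℝ) * (Nat.factorial r : ℝ) ^ (Mtot k / r) *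
                  ∏ i, (Nat.factorial (k i) : ℝ)) *
              Real.exp (-(((r : ℝ) - 1) * (M2 k : ℝ)) / (2 * (Mtot k : ℝ)) + E) := by
  have hr0 : (0 : ℝ) < r := by exact_mod_cast (by omega : 0 < r)
  refine ⟨13 * (r : ℝ) ^ 2 + 128 * r, 1 / (128 * r), by positivity, by positivity, ?_⟩
  intro n k hdvd hk2 hk3
  have hm : Mtot k / r * r = Mtot k := Nat.div_mul_cancel hdvd
  have hcardP : Fintype.card (Pts k) = Mtot k := by simp [Pts, Mtot]
  have hJ : Fintype.card (Fin (Mtot k / r)) * Fintype.card (Fin r) = Fintype.card (Pts k) := by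
    rw [hcardP, Fintype.card_fin, Fintype.card_fin, hm]
  have hK : ∀ i, ((Finset.univ : Finset (Pts k)).filter fun p => p.1 = i).card ≤ kmax k :=
    cell_card k
  have hkR : (2 : ℝ) ≤ kmax k := by exact_mod_cast hk2
  have hδ' : 128 * (r : ℝ) * (kmax k : ℝ) ^ 3 ≤ Mtot k := by
    have : 1 / (128 * (r : ℝ)) * Mtot k = Mtot k / (128 * r) := by ring
    rw [this, le_div_iff₀ (by positivity)] at hk3
    linarith
  have hδN : 128 * r * kmax k ^ 3 ≤ Mtot k := by exact_mod_cast hδ'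
  have hkk : kmax k ≤ kmax k ^ 3 := Nat.le_self_pow (by norm_num) _
  have hM16 : 16 * r * kmax k ≤ Mtot k := by
    refine le_trans ?_ hδN
    gcongr
    omega
  have hMpos : 0 < Mtot k := by
    refine lt_of_lt_of_le ?_ hM16
    have : 0 < r := by omega
    have : 0 < kmax k := by omega
    positivity
  have hA := SS_asymp (J := Fin (Mtot k / r)) (R := Fin r) (c := fun p : Pts k => p.1) (K := kmax k)
    (fun i => by convert hK i)
    (by omega) (by rw [Fintype.card_fin]; omega) (by rw [hcardP, Fintype.card_fin]; exact hM16) hJ Finset.univ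
  have hB := Rep_bound (J := Fin (Mtot k / r)) (R := Fin r) (c := fun p : Pts k => p.1) (K := kmax k)
    (fun i => by convert hK i)
    (by omega) (by rw [Fintype.card_fin]; omega) (by rw [hcardP, Fintype.card_fin]; exact hM16) hJ
  rw [hcardP, Fintype.card_fin, e2_univ] at hA
  rw [hcardP, Fintype.card_fin] at hB
  obtain ⟨hA1, hA2⟩ := hA
  have hadd := GoodS_add k r (Mtot k / r)
  have hfin := real_final (Mtot k) (kmax k) r _ ((GoodS k r (Mtot k / r)).card)
    ((RepS (fun p : Pts k => p.1) (J := Fin (Mtot k / r)) (R := Fin r)).card) (M2 k) _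
    (by exact_mod_cast hMpos) (by linarith) (by exact_mod_cast (by omega : 1 ≤ r))
    (by exact_mod_cast hA1) (by exact_mod_cast hadd) (by positivity) (by exact_mod_cast hB) hk3
    (by positivity) (by exact_mod_cast M2_le k) hA2
  obtain ⟨hG, hE⟩ := hfin
  refine ⟨_, hE, ?_⟩
  have hcard := GoodS_card k r (Mtot k / r) hm (by omega)
  have hMf : (0 : ℝ) < Nat.factorial (Mtot k) := by exact_mod_cast Nat.factorial_pos _
  have hexp : -(((r : ℝ) - 1) * (M2 k : ℝ)) / (2 * (Mtot k : ℝ)) +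
      (Real.log (GoodS k r (Mtot k / r)).card - Real.log (Nat.factorial (Mtot k)) +
        (M2 k : ℝ) * ((r : ℝ) - 1) / (2 * Mtot k)) =
      Real.log (GoodS k r (Mtot k / r)).card - Real.log (Nat.factorial (Mtot k)) := by ring
  rw [hexp, Real.exp_sub, Real.exp_log hG, Real.exp_log hMf, hcard]
  have d1 : (Nat.factorial (Mtot k / r) : ℝ) ≠ 0 := by exact_mod_cast (Nat.factorial_pos _).ne'
  have d2 : (Nat.factorial r : ℝ) ≠ 0 := by exact_mod_cast (Nat.factorial_pos _).ne'
  have d3 : (∏ i, (Nat.factorial (k i) : ℝ)) ≠ 0 :=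
    Finset.prod_ne_zero_iff.2 fun i _ => by exact_mod_cast (Nat.factorial_pos _).ne'
  push_cast
  field_simp
end

section
/- Let r ≥ 3 be a fixed integer. There exist constants C > 0 and δ > 0 depending only on r such that for all integers n and k with 2 ≤ k, k^2 ≤ δn, and r dividing kn, the number of k-regular simple r-uniform hypergraphs on vertex set {1,…,n} equals ((kn)! / ((kn/r)! · (r!)^{kn/r} · (k!)^n)) · exp(−(1/2)(k−1)(r−1) + E) for some real E with |E| ≤ C·k^2/n. -/
open scoped Classical BigOperators

namespace RHE

/-- Slot assignments in which every vertex is used exactly `k` times. -/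
noncomputable def Xs (m r n k : ℕ) : Finset (Fin m × Fin r → Fin n) :=
  Finset.univ.filter fun f => ∀ v, (Finset.univ.filter fun s => f s = v).card = k

/-- Assignments with no repeated vertex inside an edge, restricted to the slots in `P`. -/
noncomputable def AP (m r n k : ℕ) (P : Finset (Fin m × Fin r)) :
    Finset (Fin m × Fin r → Fin n) :=
  (Xs m r n k).filter fun f => ∀ x ∈ P, ∀ y ∈ P, x.1 = y.1 → x ≠ y → f x ≠ f y

variable {m r n k : ℕ}

lemma swap_mem_Xs {f : Fin m × Fin r → Fin n} (hf : f ∈ Xs m r n k) (b g : Fin m × Fin r) :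
    f ∘ Equiv.swap b g ∈ Xs m r n k := by
  simp only [Xs, Finset.mem_filter, Finset.mem_univ, true_and] at hf ⊢
  intro v
  rw [← hf v]
  apply Finset.card_bij (fun s _ => Equiv.swap b g s)
  · intro s hs; simpa using hs
  · intro s _ t _ h; simpa using h
  · intro s hs
    exact ⟨Equiv.swap b g s, by simpa using hs, by simp⟩

lemma fiber {f : Fin m × Fin r → Fin n} (hf : f ∈ Xs m r n k) (v : Fin n) :
    (Finset.univ.filter fun s => f s = v).card = k := by
  simp only [Xs, Finset.mem_filter, Finset.mem_univ, true_and] at hf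
  exact hf v

lemma edge_card (e : Fin m) :
    (Finset.univ.filter fun s : Fin m × Fin r => s.1 = e).card = r := by
  have : (Finset.univ.filter fun s : Fin m × Fin r => s.1 = e)
      = Finset.univ.image (fun i : Fin r => (e, i)) := by
    ext ⟨x, y⟩; simp [eq_comm]
  rw [this, Finset.card_image_of_injective _ (by intro x y h; simpa using h)]
  simp

lemma bad1 {f : Fin m × Fin r → Fin n} (hf : f ∈ Xs m r n k) (v : Fin n) :
    (Finset.univ.filter fun g : Fin m × Fin r => ∃ h, h.1 = g.1 ∧ f h = v).card ≤ k * r := by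
  have : (Finset.univ.filter fun g : Fin m × Fin r => ∃ h, h.1 = g.1 ∧ f h = v) ⊆
      (Finset.univ.filter fun s => f s = v).biUnion
        (fun h => Finset.univ.filter fun s : Fin m × Fin r => s.1 = h.1) := by
    intro g hg
    simp only [Finset.mem_filter, Finset.mem_univ, true_and, Finset.mem_biUnion] at hg ⊢
    obtain ⟨h, h1, h2⟩ := hg
    exact ⟨h, h2, h1.symm⟩
  refine (Finset.card_le_card this).trans ?_
  refine Finset.card_biUnion_le.trans ?_
  rw [Finset.sum_congr rfl (fun x _ => edge_card x.1)]
  simp [fiber hf]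

lemma bad2 {f : Fin m × Fin r → Fin n} (hf : f ∈ Xs m r n k) (e : Fin m) :
    (Finset.univ.filter fun g : Fin m × Fin r => ∃ h : Fin m × Fin r, h.1 = e ∧ f h = f g).card
      ≤ k * r := by
  have : (Finset.univ.filter fun g : Fin m × Fin r => ∃ h : Fin m × Fin r, h.1 = e ∧ f h = f g) ⊆
      (Finset.univ.filter fun s : Fin m × Fin r => s.1 = e).biUnion
        (fun h => Finset.univ.filter fun s => f s = f h) := by
    intro g hg
    simp only [Finset.mem_filter, Finset.mem_univ, true_and, Finset.mem_biUnion] at hg ⊢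
    obtain ⟨h, h1, h2⟩ := hg
    exact ⟨h, h1, h2.symm⟩
  refine (Finset.card_le_card this).trans ?_
  refine Finset.card_biUnion_le.trans ?_
  rw [Finset.sum_congr rfl (fun x _ => fiber hf (f x))]
  simp [edge_card, mul_comm]

lemma double_count (b : Fin m × Fin r) (A B : Finset (Fin m × Fin r → Fin n))
    (G1 G2 : (Fin m × Fin r → Fin n) → Finset (Fin m × Fin r))
    (h : ∀ f ∈ B, ∀ g ∈ G1 f, f ∘ Equiv.swap b g ∈ A ∧ g ∈ G2 (f ∘ Equiv.swap b g)) :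
    ∑ f ∈ B, (G1 f).card ≤ ∑ f ∈ A, (G2 f).card := by
  rw [← Finset.card_sigma, ← Finset.card_sigma]
  apply Finset.card_le_card_of_injOn (fun p => ⟨p.1 ∘ Equiv.swap b p.2, p.2⟩)
  · rintro ⟨f, g⟩ hp
    simp only [Finset.coe_sigma, Set.mem_sigma_iff, Finset.mem_coe] at hp ⊢
    exact h f hp.1 g hp.2
  · rintro ⟨f, g⟩ _ ⟨f', g'⟩ _ heq
    simp only [Sigma.mk.injEq, heq_eq_eq] at heq
    obtain ⟨h1, rfl⟩ := heq
    have : f = f' := by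
      funext x
      have := congrFun h1 (Equiv.swap b g x)
      simpa using this
    subst this; rfl

lemma upper (P R : Finset (Fin m × Fin r)) (Φ : (Fin m × Fin r → Fin n) → Prop)
    (a b : Fin m × Fin r) (ha : a ∈ R) (hb : b ∉ R)
    (hΦ : ∀ f g, g ∉ R → Φ f → Φ (f ∘ Equiv.swap b g)) :
    ((AP m r n k P).filter fun f => Φ f ∧ f a = f b).card * (m * r - 2 * (k * r) - R.card) ≤
      ((AP m r n k P).filter Φ).card * (k - 1) := by
  have key := double_count b ((AP m r n k P).filter Φ)
    ((AP m r n k P).filter fun f => Φ f ∧ f a = f b)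
    (fun f => ((Finset.univ \ R) \ (Finset.univ.filter fun g => ∃ h, h.1 = g.1 ∧ f h = f b)) \
      (Finset.univ.filter fun g => ∃ h : Fin m × Fin r, h.1 = b.1 ∧ f h = f g))
    (fun f => (Finset.univ.filter fun g => f g = f a).erase a) ?_
  · refine le_trans ?_ (key.trans ?_)
    · rw [← smul_eq_mul]
      apply Finset.card_nsmul_le_sum
      intro f hf
      have hX : f ∈ Xs m r n k := by
        simp only [AP, Finset.mem_filter] at hf; exact hf.1.1
      have h1 := bad1 hX (f b)
      have h2 := bad2 hX b.1
      have h3 := Finset.le_card_sdiff (Finset.univ.filter fun g => ∃ h : Fin m × Fin r, h.1 = b.1 ∧ f h = f g) ((Finset.univ \ R) \ (Finset.univ.filter fun g => ∃ h, h.1 = g.1 ∧ f h = f b))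
      have h4 := Finset.le_card_sdiff (Finset.univ.filter fun g => ∃ h, h.1 = g.1 ∧ f h = f b) (Finset.univ \ R)
      have h5 := Finset.le_card_sdiff R Finset.univ
      have h6 : (Finset.univ : Finset (Fin m × Fin r)).card = m * r := by simp
      rw [h6] at h5
      omega
    · rw [← smul_eq_mul]
      apply Finset.sum_le_card_nsmul
      intro f hf
      have hX : f ∈ Xs m r n k := by
        simp only [AP, Finset.mem_filter] at hf; exact hf.1.1
      rw [Finset.card_erase_of_mem (by simp), fiber hX]
  · intro f hf g hg
    simp only [AP, Finset.mem_filter, Finset.mem_sdiff, Finset.mem_univ, true_and, not_exists,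
      not_and] at hf hg
    obtain ⟨⟨hX, hP⟩, hF, hab⟩ := hf
    obtain ⟨⟨hgR, hg1⟩, hg2⟩ := hg
    have hane : a ≠ b := fun h => hb (h ▸ ha)
    have hang : a ≠ g := fun h => hgR (h ▸ ha)
    simp only [AP, Finset.mem_filter, Finset.mem_erase, Finset.mem_univ, true_and]
    refine ⟨⟨⟨swap_mem_Xs hX b g, ?_⟩, hΦ f g hgR hF⟩, hang.symm, ?_⟩
    · intro x hx y hy hxy hne
      simp only [Function.comp_apply, Equiv.swap_apply_def]
      have q1 := hg1 g rfl
      have q2 := hg1 x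
      have q3 := hg1 y
      have q4 := hg2 x
      have q5 := hg2 y
      have q6 := hP x hx y hy hxy hne
      split_ifs <;> grind
    · simp [Equiv.swap_apply_of_ne_of_ne hane hang, hab]

lemma lower (P : Finset (Fin m × Fin r)) (a b : Fin m × Fin r) (hab : a ≠ b) (hb : b ∉ P) :
    (AP m r n k P).card * (k - 1) ≤
      ((AP m r n k P).filter fun f => f a = f b).card * (m * r - 1) +
      ∑ f ∈ AP m r n k P, (Finset.univ.filter fun g : Fin m × Fin r =>
        f g = f a ∧ g ∈ P ∧ ∃ y ∈ P, y.1 = g.1 ∧ f y = f b).card := by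
  have key := double_count b ((AP m r n k P).filter fun f => f a = f b)
    (AP m r n k P)
    (fun f => ((Finset.univ.filter fun g => f g = f a).erase a) \
      (Finset.univ.filter fun g : Fin m × Fin r =>
        f g = f a ∧ g ∈ P ∧ ∃ y ∈ P, y.1 = g.1 ∧ f y = f b))
    (fun f => Finset.univ.erase a) ?_
  · have h2 : ∑ f ∈ (AP m r n k P).filter (fun f => f a = f b),
        ((Finset.univ : Finset (Fin m × Fin r)).erase a).card =
        ((AP m r n k P).filter fun f => f a = f b).card * (m * r - 1) := by
      rw [Finset.sum_const, smul_eq_mul, Finset.card_erase_of_mem (by simp)]; simp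
    rw [h2] at key
    refine le_trans ?_ (Nat.add_le_add_right key _)
    rw [← Finset.sum_add_distrib, ← smul_eq_mul]
    apply Finset.card_nsmul_le_sum
    intro f hf
    have hX : f ∈ Xs m r n k := by
      simp only [AP, Finset.mem_filter] at hf; exact hf.1
    have h3 := Finset.le_card_sdiff (Finset.univ.filter fun g : Fin m × Fin r =>
        f g = f a ∧ g ∈ P ∧ ∃ y ∈ P, y.1 = g.1 ∧ f y = f b)
        ((Finset.univ.filter fun g => f g = f a).erase a)
    rw [Finset.card_erase_of_mem (by simp), fiber hX] at h3
    omega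
  · intro f hf g hg
    simp only [AP, Finset.mem_filter, Finset.mem_sdiff, Finset.mem_erase, Finset.mem_univ, true_and,
      not_exists, not_and] at hf hg
    obtain ⟨hX, hP⟩ := hf
    obtain ⟨⟨hga, hgf⟩, hgb⟩ := hg
    simp only [AP, Finset.mem_filter, Finset.mem_erase, Finset.mem_univ, and_true]
    refine ⟨⟨⟨swap_mem_Xs hX b g, ?_⟩, ?_⟩, hga⟩
    · intro x hx y hy hxy hne
      simp only [Function.comp_apply, Equiv.swap_apply_def]
      have q1 := hgb hgf
      have q6 := hP x hx y hy hxy hne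
      have q2 := fun h => q1 h x hx
      have q3 := fun h => q1 h y hy
      split_ifs <;> grind
    · simp [Equiv.swap_apply_of_ne_of_ne hab (Ne.symm hga), hgf]

lemma badsum (P : Finset (Fin m × Fin r)) (a b : Fin m × Fin r) (hab : a ≠ b) (hb : b ∉ P) :
    (∑ f ∈ AP m r n k P, (Finset.univ.filter fun g : Fin m × Fin r =>
        f g = f a ∧ g ∈ P ∧ ∃ y ∈ P, y.1 = g.1 ∧ f y = f b).card) * (m * r - 2 * (k * r) - 3) ≤
      (AP m r n k P).card * (k * r * (k - 1)) := by
  have h1 : (∑ f ∈ AP m r n k P, (Finset.univ.filter fun g : Fin m × Fin r =>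
        f g = f a ∧ g ∈ P ∧ ∃ y ∈ P, y.1 = g.1 ∧ f y = f b).card) ≤
      ∑ g ∈ P, ∑ y ∈ P.filter (fun y => y.1 = g.1),
        ((AP m r n k P).filter fun f => f g = f a ∧ f y = f b).card := by
    have e1 : ∀ g y, ((AP m r n k P).filter fun f => f g = f a ∧ f y = f b).card
        = ∑ f ∈ AP m r n k P, if f g = f a ∧ f y = f b then 1 else 0 := by
      intro g y; rw [Finset.card_filter]
    simp_rw [e1]
    have e2 : ∀ g ∈ P, ∑ y ∈ P.filter (fun y => y.1 = g.1),
        (∑ f ∈ AP m r n k P, if f g = f a ∧ f y = f b then 1 else 0) =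
        ∑ f ∈ AP m r n k P, ∑ y ∈ P.filter (fun y => y.1 = g.1),
          if f g = f a ∧ f y = f b then 1 else 0 := fun g _ => Finset.sum_comm
    rw [Finset.sum_congr rfl e2, Finset.sum_comm]
    apply Finset.sum_le_sum
    intro f _
    rw [Finset.card_filter, ← Finset.sum_subset (Finset.subset_univ P)]
    · apply Finset.sum_le_sum
      intro g hg
      split_ifs with h
      · obtain ⟨h1, -, y, hy, hy1, hy2⟩ := h
        have := Finset.single_le_sum (s := P.filter (fun y => y.1 = g.1))
          (f := fun y => if f g = f a ∧ f y = f b then 1 else 0) (fun _ _ => Nat.zero_le _)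
          (Finset.mem_filter.mpr ⟨hy, hy1⟩)
        simpa [h1, hy2] using this
      · exact Nat.zero_le _
    · intro g _ hg
      simp [hg]
  have h2 : ∀ g ∈ P, ∀ y ∈ P.filter (fun y => y.1 = g.1),
      ((AP m r n k P).filter fun f => f g = f a ∧ f y = f b).card * (m * r - 2 * (k * r) - 3) ≤
      ((AP m r n k P).filter fun f => f g = f a).card * (k - 1) := by
    intro g hg y hy
    have hyP := (Finset.mem_filter.mp hy).1
    have hyb : b ≠ y := fun h => hb (h ▸ hyP)
    have hgb : b ≠ g := fun h => hb (h ▸ hg)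
    have hup := upper (k := k) P {a, g, y} (fun f : Fin m × Fin r → Fin n => f g = f a) y b (by simp)
      (by simp [hyb, hgb, hab.symm]) (by
        intro f h hh hf
        simp only [Finset.mem_insert, Finset.mem_singleton, not_or] at hh
        simp only [Function.comp_apply]
        rw [Equiv.swap_apply_of_ne_of_ne hgb.symm (Ne.symm hh.2.1),
          Equiv.swap_apply_of_ne_of_ne hab (Ne.symm hh.1)]
        exact hf)
    have h3 : ({a, g, y} : Finset (Fin m × Fin r)).card ≤ 3 := Finset.card_le_three
    have h4 : m * r - 2 * (k * r) - 3 ≤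
      m * r - 2 * (k * r) - ({a, g, y} : Finset (Fin m × Fin r)).card := by omega
    refine Nat.le_trans (Nat.mul_le_mul_left _ h4) ?_
    convert hup
  calc _ ≤ (∑ g ∈ P, ∑ y ∈ P.filter (fun y => y.1 = g.1),
        ((AP m r n k P).filter fun f => f g = f a ∧ f y = f b).card) * (m * r - 2 * (k * r) - 3) :=
        Nat.mul_le_mul_right _ h1
    _ ≤ ∑ g ∈ P, ∑ y ∈ P.filter (fun y => y.1 = g.1),
        ((AP m r n k P).filter fun f => f g = f a).card * (k - 1) := by
        rw [Finset.sum_mul]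
        apply Finset.sum_le_sum
        intro g hg
        rw [Finset.sum_mul]
        exact Finset.sum_le_sum (h2 g hg)
    _ ≤ ∑ g ∈ P, r * (((AP m r n k P).filter fun f => f g = f a).card * (k - 1)) := by
        apply Finset.sum_le_sum
        intro g hg
        rw [Finset.sum_const, smul_eq_mul]
        apply Nat.mul_le_mul_right
        exact (Finset.card_le_card (Finset.filter_subset_filter _ (Finset.subset_univ _))).trans
          (edge_card (m := m) (r := r) g.1).le
    _ = r * (k - 1) * ∑ g ∈ P, ((AP m r n k P).filter fun f => f g = f a).card := by
        rw [Finset.mul_sum]; apply Finset.sum_congr rfl; intros; ring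
    _ ≤ r * (k - 1) * ((AP m r n k P).card * k) := by
        apply Nat.mul_le_mul_left
        have e1 : ∀ g, ((AP m r n k P).filter fun f => f g = f a).card
            = ∑ f ∈ AP m r n k P, if f g = f a then 1 else 0 := by
          intro g; rw [Finset.card_filter]
        simp_rw [e1]
        rw [Finset.sum_comm, ← smul_eq_mul]
        apply Finset.sum_le_card_nsmul
        intro f hf
        have hX : f ∈ Xs m r n k := by
          simp only [AP, Finset.mem_filter] at hf; exact hf.1
        rw [← Finset.card_filter, ← fiber hX (f a)]
        exact Finset.card_le_card (Finset.filter_subset_filter _ (Finset.subset_univ _))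
    _ = _ := by ring

lemma upper_real (hk : 2 ≤ k) (hr : 1 ≤ r) (hM : m * r = k * n) (hn : 20 * r ≤ n)
    (P R : Finset (Fin m × Fin r)) (Φ : (Fin m × Fin r → Fin n) → Prop)
    (a b : Fin m × Fin r) (ha : a ∈ R) (hb : b ∉ R) (hR : R.card ≤ 5)
    (hΦ : ∀ f g, g ∉ R → Φ f → Φ (f ∘ Equiv.swap b g)) :
    (((AP m r n k P).filter fun f => Φ f ∧ f a = f b).card : ℝ) ≤
      (((AP m r n k P).filter Φ).card : ℝ) * (2 / n) := by
  have h := upper (k := k) P R Φ a b ha hb hΦ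
  set B := ((AP m r n k P).filter fun f => Φ f ∧ f a = f b).card
  set A := ((AP m r n k P).filter Φ).card
  have h1 : k * n ≤ 2 * (m * r - 2 * (k * r) - R.card) := by
    have e1 : k * (20 * r) ≤ k * n := Nat.mul_le_mul_left _ hn
    have e2 : 2 * 1 ≤ k * r := Nat.mul_le_mul hk hr
    have e3 : k * (20 * r) = 20 * (k * r) := by ring
    omega
  have h2 : B * (k * n) ≤ A * (k * 2) := by
    calc B * (k * n) ≤ B * (2 * (m * r - 2 * (k * r) - R.card)) := Nat.mul_le_mul_left _ h1
      _ = 2 * (B * (m * r - 2 * (k * r) - R.card)) := by ring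
      _ ≤ 2 * (A * (k - 1)) := Nat.mul_le_mul_left _ h
      _ ≤ 2 * (A * k) := Nat.mul_le_mul_left _ (Nat.mul_le_mul_left _ (Nat.sub_le _ _))
      _ = _ := by ring
  have h3 : B * n ≤ A * 2 := by
    refine Nat.le_of_mul_le_mul_left (c := k) ?_ (by omega)
    calc k * (B * n) = B * (k * n) := by ring
      _ ≤ _ := h2
      _ = _ := by ring
  have h4 : (B : ℝ) * n ≤ A * 2 := by exact_mod_cast h3
  have hn0 : (0 : ℝ) < n := by
    have : 0 < n := by omega
    exact_mod_cast this
  rw [← mul_div_assoc, le_div_iff₀ hn0]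
  exact h4

lemma ratio_num (hk : 2 ≤ k) (hr : 1 ≤ r) (hn : 20 * r ≤ n) (A B S : ℕ)
    (hu : B * (k * n - 2 * (k * r) - 1) ≤ A * (k - 1))
    (hl : A * (k - 1) ≤ B * (k * n - 1) + S)
    (hs : S * (k * n - 2 * (k * r) - 3) ≤ A * (k * r * (k - 1))) :
    |(B : ℝ) - (A : ℝ) * (((k : ℝ) - 1) / (k * n))| ≤ (A : ℝ) * (6 * r / (n : ℝ) ^ 2) := by
  have e1 : k * (20 * r) ≤ k * n := Nat.mul_le_mul_left _ hn
  have e2 : 2 * 1 ≤ k * r := Nat.mul_le_mul hk hr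
  have e3 : k * (20 * r) = 20 * (k * r) := by ring
  have hu' : (B : ℝ) * (k * n - 2 * (k * r) - 1) ≤ A * (k - 1) := by
    have : ((k * n - 2 * (k * r) - 1 : ℕ) : ℝ) = k * n - 2 * (k * r) - 1 := by
      rw [Nat.cast_sub (by omega), Nat.cast_sub (by omega)]; push_cast; ring
    rw [← this]
    have h2 : ((k - 1 : ℕ) : ℝ) = k - 1 := by rw [Nat.cast_sub (by omega)]; simp
    rw [← h2]; exact_mod_cast hu
  have hl' : (A : ℝ) * (k - 1) ≤ B * (k * n) + S := by
    have h2 : ((k - 1 : ℕ) : ℝ) = k - 1 := by rw [Nat.cast_sub (by omega)]; simp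
    rw [← h2]
    have : A * (k - 1) ≤ B * (k * n) + S :=
      hl.trans (Nat.add_le_add_right (Nat.mul_le_mul_left _ (Nat.sub_le _ _)) _)
    exact_mod_cast this
  have hs' : (S : ℝ) * (k * n - 2 * (k * r) - 3) ≤ A * (k * r * (k - 1)) := by
    have : ((k * n - 2 * (k * r) - 3 : ℕ) : ℝ) = k * n - 2 * (k * r) - 3 := by
      rw [Nat.cast_sub (by omega), Nat.cast_sub (by omega)]; push_cast; ring
    rw [← this]
    have h2 : ((k - 1 : ℕ) : ℝ) = k - 1 := by rw [Nat.cast_sub (by omega)]; simp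
    rw [← h2]; exact_mod_cast hs
  have hkR : (2 : ℝ) ≤ k := by exact_mod_cast hk
  have hrR : (1 : ℝ) ≤ r := by exact_mod_cast hr
  have hnR : (20 : ℝ) * r ≤ n := by exact_mod_cast hn
  have hB0 : (0 : ℝ) ≤ B := Nat.cast_nonneg _
  have hS0 : (0 : ℝ) ≤ S := Nat.cast_nonneg _
  have hA0 : (0 : ℝ) ≤ A := Nat.cast_nonneg _
  have hn0 : (0 : ℝ) < n := by linarith
  have hk0 : (0 : ℝ) < k := by linarith
  have f1 : (k : ℝ) * (20 * r) ≤ k * n := mul_le_mul_of_nonneg_left hnR hk0.le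
  have f2 : (2 : ℝ) * 1 ≤ k * r := by exact_mod_cast e2
  have hhalf : (k : ℝ) * n / 2 ≤ k * n - 2 * (k * r) - 3 := by linarith
  have hhalf' : (k : ℝ) * n / 2 ≤ k * n - 2 * (k * r) - 1 := by linarith
  -- crude bounds
  have hBn : (B : ℝ) * n ≤ 2 * A := by
    have : (B : ℝ) * (k * n / 2) ≤ A * (k - 1) :=
      (mul_le_mul_of_nonneg_left hhalf' hB0).trans hu'
    have h3 : (B : ℝ) * n * k ≤ 2 * A * k := by linarith
    exact le_of_mul_le_mul_right h3 hk0
  have hSn : (S : ℝ) * n ≤ 2 * A * (r * k) := by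
    have : (S : ℝ) * (k * n / 2) ≤ A * (k * r * (k - 1)) :=
      (mul_le_mul_of_nonneg_left hhalf hS0).trans hs'
    have h4 : 0 ≤ (A : ℝ) * (k * r) := by positivity
    have h3 : (S : ℝ) * n * k ≤ 2 * A * (r * k) * k := by linarith
    exact le_of_mul_le_mul_right h3 hk0
  have hU : (B : ℝ) * (k * n) - A * (k - 1) ≤ A * (6 * (k * r) / n) := by
    have h1 : (B : ℝ) * (k * n) - A * (k - 1) ≤ B * (3 * (k * r)) := by
      have h7 := mul_le_mul_of_nonneg_left f2 hB0
      linarith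
    refine h1.trans ?_
    rw [← mul_div_assoc, le_div_iff₀ hn0]
    have h5 : 0 ≤ 3 * ((k : ℝ) * r) := by positivity
    have h6 := mul_le_mul_of_nonneg_right hBn h5
    linarith
  have hL : (A : ℝ) * (k - 1) - B * (k * n) ≤ A * (6 * (k * r) / n) := by
    have h1 : (A : ℝ) * (k - 1) - B * (k * n) ≤ S := by linarith
    refine h1.trans ?_
    rw [← mul_div_assoc, le_div_iff₀ hn0]
    have h5 : 0 ≤ (A : ℝ) * (k * r) := by positivity
    linarith
  have hkn : (0 : ℝ) < k * n := by positivity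
  have heq : (B : ℝ) - A * (((k : ℝ) - 1) / (k * n)) = (B * (k * n) - A * (k - 1)) / (k * n) := by
    field_simp
  have heq2 : (A : ℝ) * (6 * r / (n : ℝ) ^ 2) = A * (6 * (k * r) / n) / (k * n) := by
    field_simp
  rw [heq, heq2, abs_div, abs_of_pos hkn]
  apply div_le_div_of_nonneg_right _ hkn.le
  rw [abs_le]
  constructor <;> linarith

lemma ratio (hk : 2 ≤ k) (hr : 1 ≤ r) (hM : m * r = k * n) (hn : 20 * r ≤ n)
    (P : Finset (Fin m × Fin r)) (a b : Fin m × Fin r) (hab : a ≠ b) (hb : b ∉ P) :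
    |(((AP m r n k P).filter fun f => f a = f b).card : ℝ) -
      ((AP m r n k P).card : ℝ) * (((k : ℝ) - 1) / (k * n))| ≤
      ((AP m r n k P).card : ℝ) * (6 * r / (n : ℝ) ^ 2) := by
  have hu := upper (k := k) (n := n) P {a} (fun _ => True) a b (by simp)
    (by simpa using hab.symm) (fun _ _ _ _ => trivial)
  simp only [true_and, Finset.filter_true, Finset.card_singleton] at hu
  have hl := lower (k := k) (n := n) P a b hab hb
  have hs := badsum (k := k) (n := n) P a b hab hb
  rw [hM] at hu hl hs
  exact ratio_num hk hr hn _ _ _ hu hl hs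

lemma AP_insert (P : Finset (Fin m × Fin r)) (b : Fin m × Fin r) (hb : b ∉ P) :
    (AP m r n k P).card = (AP m r n k (insert b P)).card +
      ∑ a ∈ P.filter (fun a => a.1 = b.1), ((AP m r n k P).filter fun f => f a = f b).card := by
  have hdis : ∀ x ∈ P.filter (fun a => a.1 = b.1), ∀ y ∈ P.filter (fun a => a.1 = b.1), x ≠ y →
      Disjoint ((AP m r n k P).filter fun f => f x = f b)
        ((AP m r n k P).filter fun f => f y = f b) := by
    intro x hx y hy hne
    rw [Finset.disjoint_left]
    intro f hf hf'
    simp only [AP, Finset.mem_filter] at hf hf' hx hy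
    exact hf.1.2 x hx.1 y hy.1 (hx.2.trans hy.2.symm) hne (hf.2.trans hf'.2.symm)
  rw [← Finset.card_biUnion hdis, ← Finset.card_union_of_disjoint]
  · congr 1
    ext f
    simp only [Finset.mem_union, Finset.mem_biUnion, Finset.mem_filter]
    constructor
    · intro hf
      by_cases h : ∃ a, (a ∈ P ∧ a.1 = b.1) ∧ f a = f b
      · obtain ⟨a, ha, hab⟩ := h
        exact Or.inr ⟨a, ha, hf, hab⟩
      · left
        push Not at h
        simp only [AP, Finset.mem_filter, Finset.mem_insert] at hf ⊢
        refine ⟨hf.1, ?_⟩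
        rintro x (rfl | hx) y (rfl | hy) hxy hne
        · exact absurd rfl hne
        · exact (h y ⟨hy, hxy.symm⟩).symm
        · exact h x ⟨hx, hxy⟩
        · exact hf.2 x hx y hy hxy hne
    · rintro (hf | ⟨a, -, hf, -⟩)
      · simp only [AP, Finset.mem_filter] at hf ⊢
        exact ⟨hf.1, fun x hx y hy => hf.2 x (Finset.mem_insert_of_mem hx) y
          (Finset.mem_insert_of_mem hy)⟩
      · exact hf
  · rw [Finset.disjoint_left]
    intro f hf hf'
    simp only [Finset.mem_biUnion, Finset.mem_filter] at hf'
    obtain ⟨a, ⟨ha, hab⟩, -, hfa⟩ := hf'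
    simp only [AP, Finset.mem_filter] at hf
    exact hf.2 a (Finset.mem_insert_of_mem ha) b (Finset.mem_insert_self _ _) hab
      (fun h => hb (h ▸ ha)) hfa

/-- number of ordered pairs of distinct slots of `P` in the same edge -/
noncomputable def phi (P : Finset (Fin m × Fin r)) : ℕ :=
  ∑ x ∈ P, (P.filter fun y => y.1 = x.1 ∧ y ≠ x).card

lemma phi_insert (P : Finset (Fin m × Fin r)) (b : Fin m × Fin r) (hb : b ∉ P) :
    phi (insert b P) = phi P + 2 * (P.filter fun a => a.1 = b.1).card := by
  unfold phi
  rw [Finset.sum_insert hb]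
  have h1 : ((insert b P).filter fun y => y.1 = b.1 ∧ y ≠ b) = P.filter fun a => a.1 = b.1 := by
    ext y
    simp only [Finset.mem_filter, Finset.mem_insert]
    constructor
    · rintro ⟨rfl | h, h1, h2⟩
      · exact absurd rfl h2
      · exact ⟨h, h1⟩
    · rintro ⟨h, h1⟩
      exact ⟨Or.inr h, h1, fun h' => hb (h' ▸ h)⟩
  have h2 : ∀ x ∈ P, ((insert b P).filter fun y => y.1 = x.1 ∧ y ≠ x).card =
      (P.filter fun y => y.1 = x.1 ∧ y ≠ x).card + if x.1 = b.1 then 1 else 0 := by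
    intro x hx
    have hxb : b ≠ x := fun h => hb (h ▸ hx)
    rw [Finset.filter_insert]
    split_ifs with h h' h'
    · rw [Finset.card_insert_of_notMem]
      simp [hb]
    · exact absurd h.1.symm h'
    · exact absurd ⟨h'.symm, hxb⟩ h
    · rfl
  rw [h1, Finset.sum_congr rfl h2, Finset.sum_add_distrib, ← Finset.card_filter]
  ring

lemma phi_univ : phi (Finset.univ : Finset (Fin m × Fin r)) = m * r * (r - 1) := by
  unfold phi
  have : ∀ x ∈ (Finset.univ : Finset (Fin m × Fin r)),
      ((Finset.univ : Finset (Fin m × Fin r)).filter fun y => y.1 = x.1 ∧ y ≠ x).card = r - 1 := by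
    intro x _
    have h : ((Finset.univ : Finset (Fin m × Fin r)).filter fun y => y.1 = x.1 ∧ y ≠ x) =
        (Finset.univ.filter fun y : Fin m × Fin r => y.1 = x.1).erase x := by
      ext y; simp [and_comm]
    rw [h, Finset.card_erase_of_mem (by simp), edge_card]
  rw [Finset.sum_congr rfl this]
  simp

lemma main_induct (hk : 2 ≤ k) (hr : 1 ≤ r) (hM : m * r = k * n) (hn : 20 * r ≤ n)
    (hX : 0 < (Xs m r n k).card) (P : Finset (Fin m × Fin r)) :
    0 < (AP m r n k P).card ∧
    |Real.log ((AP m r n k P).card : ℝ) - Real.log ((Xs m r n k).card : ℝ) +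
      phi P * (((k : ℝ) - 1) / (2 * (k * n)))| ≤ P.card * (14 * (r : ℝ) ^ 2 / (n : ℝ) ^ 2) := by
  have hkR : (2 : ℝ) ≤ k := by exact_mod_cast hk
  have hrR : (1 : ℝ) ≤ r := by exact_mod_cast hr
  have hnR : (20 : ℝ) * r ≤ n := by exact_mod_cast hn
  have hn0 : (0 : ℝ) < n := by linarith
  have hk0 : (0 : ℝ) < k := by linarith
  induction P using Finset.induction_on with
  | empty =>
    have : AP m r n k ∅ = Xs m r n k := by simp [AP]
    rw [this]
    exact ⟨hX, by simp [phi]⟩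
  | insert b P hb ih =>
    obtain ⟨hA, ih⟩ := ih
    have hins := AP_insert (n := n) (k := k) P b hb
    have hrat : ∀ a ∈ P.filter (fun a => a.1 = b.1), _ := fun a ha =>
      ratio hk hr hM hn P a b (fun h => hb (h ▸ (Finset.mem_filter.mp ha).1)) hb
    have hsum : |∑ a ∈ P.filter (fun a => a.1 = b.1),
        ((((AP m r n k P).filter fun f => f a = f b).card : ℝ) -
          ((AP m r n k P).card : ℝ) * (((k : ℝ) - 1) / (k * n)))| ≤
        ∑ a ∈ P.filter (fun a => a.1 = b.1), ((AP m r n k P).card : ℝ) * (6 * r / (n : ℝ) ^ 2) :=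
      (Finset.abs_sum_le_sum_abs _ _).trans (Finset.sum_le_sum hrat)
    rw [Finset.sum_sub_distrib, Finset.sum_const, Finset.sum_const, nsmul_eq_mul,
      nsmul_eq_mul] at hsum
    rw [phi_insert P b hb, Finset.card_insert_of_notMem hb]
    have ht : (P.filter (fun a => a.1 = b.1)).card ≤ r :=
      (Finset.card_le_card (Finset.filter_subset_filter _ (Finset.subset_univ _))).trans
          (edge_card (m := m) (r := r) b.1).le
    have hins' : ((AP m r n k P).card : ℝ) = ((AP m r n k (insert b P)).card : ℝ) +
      ∑ a ∈ P.filter (fun a => a.1 = b.1),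
        (((AP m r n k P).filter fun f => f a = f b).card : ℝ) := by exact_mod_cast hins
    have hsn : 0 ≤ ∑ a ∈ P.filter (fun a => a.1 = b.1),
        (((AP m r n k P).filter fun f => f a = f b).card : ℝ) :=
      Finset.sum_nonneg (fun _ _ => Nat.cast_nonneg _)
    set T := ∑ a ∈ P.filter (fun a => a.1 = b.1),
        (((AP m r n k P).filter fun f => f a = f b).card : ℝ)
    set t := (P.filter (fun a => a.1 = b.1)).card
    have htR : (t : ℝ) ≤ r := by exact_mod_cast ht
    have ht0 : (0 : ℝ) ≤ t := Nat.cast_nonneg _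
    have hAR : (0 : ℝ) < (AP m r n k P).card := by exact_mod_cast hA
    set A : ℝ := ((AP m r n k P).card : ℝ)
    obtain ⟨x, hx⟩ : ∃ x, x = T / A := ⟨_, rfl⟩
    have hx0 : 0 ≤ x := hx ▸ div_nonneg hsn hAR.le
    have hTx : T = A * x := by rw [hx, mul_div_cancel₀ _ hAR.ne']
    have hA' : ((AP m r n k (insert b P)).card : ℝ) = A * (1 - x) := by
      rw [mul_sub, ← hTx]; linarith
    have hd : |x - t * (((k : ℝ) - 1) / (k * n))| ≤ 6 * (r : ℝ) ^ 2 / (n : ℝ) ^ 2 := by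
      have e : T - t * (A * (((k : ℝ) - 1) / (k * n))) =
          A * (x - t * (((k : ℝ) - 1) / (k * n))) := by rw [hTx]; ring
      rw [e, abs_mul, abs_of_pos hAR] at hsum
      have e2 : (t : ℝ) * (A * (6 * r / (n : ℝ) ^ 2)) ≤ A * (6 * (r : ℝ) ^ 2 / (n : ℝ) ^ 2) := by
        have : 0 ≤ A * (6 * r / (n : ℝ) ^ 2) := mul_nonneg hAR.le (by positivity)
        calc _ ≤ (r : ℝ) * (A * (6 * r / (n : ℝ) ^ 2)) := mul_le_mul_of_nonneg_right htR this
          _ = _ := by ring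
      exact le_of_mul_le_mul_left (hsum.trans e2) hAR
    have hrn : (r : ℝ) / n ≤ 1 / 20 := by rw [div_le_iff₀ hn0]; linarith
    have hrn0 : 0 ≤ (r : ℝ) / n := by positivity
    have hq : (t : ℝ) * (((k : ℝ) - 1) / (k * n)) ≤ r / n := by
      have h1 : ((k : ℝ) - 1) / (k * n) ≤ 1 / n := by
        rw [div_le_div_iff₀ (by positivity) hn0]; nlinarith
      calc _ ≤ (r : ℝ) * (1 / n) := by
            apply mul_le_mul htR h1 _ (by positivity)
            apply div_nonneg (by linarith) (by positivity)
        _ = _ := by ring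
    have hsq : 6 * (r : ℝ) ^ 2 / (n : ℝ) ^ 2 = 6 * ((r : ℝ) / n) ^ 2 := by ring
    have hx2 : x ≤ 2 * ((r : ℝ) / n) := by
      have := (abs_le.mp hd).2
      rw [hsq] at this
      nlinarith
    have hx1 : x ≤ 1 / 10 := by linarith
    have hlog := Real.abs_log_sub_add_sum_range_le (x := x) (by rw [abs_of_nonneg hx0]; linarith) 1
    simp only [Finset.sum_range_one, Nat.cast_zero, zero_add, pow_one, div_one,
      abs_of_nonneg hx0] at hlog
    have hlog2 : |x + Real.log (1 - x)| ≤ 8 * ((r : ℝ) / n) ^ 2 := by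
      refine hlog.trans ?_
      rw [div_le_iff₀ (by linarith)]
      norm_num
      nlinarith [mul_nonneg hrn0 hrn0]
    refine ⟨?_, ?_⟩
    · have : (0 : ℝ) < (AP m r n k (insert b P)).card := by
        rw [hA']; exact mul_pos hAR (by linarith)
      exact_mod_cast this
    · rw [hA', Real.log_mul hAR.ne' (by linarith)]
      have hc : t * (((k : ℝ) - 1) / (k * n)) = 2 * t * (((k : ℝ) - 1) / (2 * (k * n))) := by
        field_simp
      rw [hsq] at hd
      have hcc : 14 * (r : ℝ) ^ 2 / (n : ℝ) ^ 2 = 14 * ((r : ℝ) / n) ^ 2 := by ring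
      rw [hcc] at ih ⊢
      rw [hc] at hd
      push_cast
      generalize ((r : ℝ) / n) ^ 2 = y at ih hd hlog2 ⊢
      generalize ((k : ℝ) - 1) / (2 * (k * n)) = z at ih hd hlog2 ⊢
      generalize Real.log (1 - x) = l1 at ih hd hlog2 ⊢
      generalize Real.log A = l2 at ih hd hlog2 ⊢
      generalize Real.log ((Xs m r n k).card : ℝ) = l3 at ih hd hlog2 ⊢
      rw [abs_le] at ih hd hlog2 ⊢
      constructor <;> linarith

lemma card_Xs (hM : m * r = k * n) :
    (Xs m r n k).card * (Nat.factorial k) ^ n = Nat.factorial (k * n) := by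
  have e0 : Fin m × Fin r ≃ Fin n × Fin k :=
    Fintype.equivOfCardEq (by simp [hM, mul_comm])
  set f0 : Fin m × Fin r → Fin n := fun s => (e0 s).1 with hf0
  have hf0X : f0 ∈ Xs m r n k := by
    simp only [Xs, Finset.mem_filter, Finset.mem_univ, true_and]
    intro v
    have : (Finset.univ.filter fun s => f0 s = v) =
        Finset.univ.image (fun i : Fin k => e0.symm (v, i)) := by
      ext s
      simp only [Finset.mem_filter, Finset.mem_univ, true_and, Finset.mem_image, hf0]
      constructor
      · intro h
        exact ⟨(e0 s).2, by rw [Equiv.symm_apply_eq, ← h]⟩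
      · rintro ⟨i, rfl⟩
        simp
    rw [this, Finset.card_image_of_injective _ (by intro x y h; simpa using h)]
    simp
  have hmap : ∀ σ ∈ (Finset.univ : Finset (Equiv.Perm (Fin m × Fin r))),
      f0 ∘ σ ∈ Xs m r n k := by
    intro σ _
    simp only [Xs, Finset.mem_filter, Finset.mem_univ, true_and]
    intro v
    rw [← fiber hf0X v]
    apply Finset.card_bij (fun s _ => σ s)
    · intro s hs; simpa using hs
    · intro s _ t _ h; simpa using h
    · intro s hs
      exact ⟨σ.symm s, by simpa using hs, by simp⟩
  have hcount := Finset.card_eq_sum_card_fiberwise hmap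
  rw [Finset.card_univ, Fintype.card_perm, Fintype.card_prod, Fintype.card_fin, Fintype.card_fin,
    hM] at hcount
  rw [hcount, ← smul_eq_mul, ← Finset.sum_const]
  apply Finset.sum_congr rfl
  intro f hf
  have hσ : ∃ σ0 : Equiv.Perm (Fin m × Fin r), f0 ∘ σ0 = f := by
    have hE : ∀ v, Nonempty ({a // f a = v} ≃ {b // f0 b = v}) := by
      intro v
      refine ⟨Fintype.equivOfCardEq ?_⟩
      rw [Fintype.card_subtype, Fintype.card_subtype, fiber hf, fiber hf0X]
    refine ⟨Equiv.ofFiberEquiv (fun v => (hE v).some), ?_⟩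
    funext s
    exact Equiv.ofFiberEquiv_map _ s
  obtain ⟨σ0, hσ0⟩ := hσ
  have hst := DomMulAct.stabilizer_card f
  have hp : ∀ v, Fintype.card {a // f a = v} = k := by
    intro v; rw [Fintype.card_subtype, fiber hf]
  simp only [hp, Finset.prod_const, Finset.card_univ, Fintype.card_fin] at hst
  rw [← hst, Fintype.card_subtype]
  apply Finset.card_bij (fun σ _ => σ0 * σ)
  · intro σ hs
    simp only [Finset.mem_filter, Finset.mem_univ, true_and] at hs ⊢
    rw [Equiv.Perm.coe_mul, ← Function.comp_assoc, hσ0, hs]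
  · intro s _ t _ h; simpa using h
  · intro τ hτ
    simp only [Finset.mem_filter, Finset.mem_univ, true_and] at hτ ⊢
    refine ⟨σ0⁻¹ * τ, ?_, by simp⟩
    calc f ∘ ⇑(σ0⁻¹ * τ) = (f0 ∘ σ0) ∘ ⇑(σ0⁻¹ * τ) := by rw [hσ0]
      _ = f0 ∘ ⇑(σ0 * (σ0⁻¹ * τ)) := by rw [Function.comp_assoc, ← Equiv.Perm.coe_mul]
      _ = f := by rw [mul_inv_cancel_left, hτ]

/-- The vertex set of edge `e`. -/
def es (f : Fin m × Fin r → Fin n) (e : Fin m) : Finset (Fin n) :=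
  Finset.univ.image (fun i => f (e, i))

/-- Assignments giving simple hypergraphs. -/
noncomputable def Sim (m r n k : ℕ) : Finset (Fin m × Fin r → Fin n) :=
  (AP m r n k Finset.univ).filter fun f => ∀ e e', e ≠ e' → es f e ≠ es f e'

/-- Regular hypergraphs -/
noncomputable def HF (r n k : ℕ) : Finset (Finset (Finset (Fin n))) :=
  Finset.univ.filter fun E =>
    (∀ e ∈ E, e.card = r) ∧ ∀ i, (E.filter fun e => i ∈ e).card = k

lemma HF_card : (HF r n k).card = Hcount r (fun _ : Fin n => k) := by
  unfold HF Hcount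
  rw [← Set.ncard_coe_finset]
  congr 1
  ext E
  simp

lemma card_of_HF (hr : 0 < r) (hM : m * r = k * n) {E : Finset (Finset (Fin n))}
    (hE : E ∈ HF r n k) : E.card = m := by
  simp only [HF, Finset.mem_filter, Finset.mem_univ, true_and] at hE
  have h1 : ∑ i : Fin n, (E.filter fun e => i ∈ e).card = ∑ e ∈ E, e.card := by
    simp_rw [Finset.card_filter]
    rw [Finset.sum_comm]
    apply Finset.sum_congr rfl
    intro e _
    simp
  rw [Finset.sum_congr rfl (fun i _ => hE.2 i), Finset.sum_congr rfl hE.1] at h1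
  simp at h1
  apply Nat.eq_of_mul_eq_mul_right hr
  rw [← h1, hM, mul_comm]

/-- Labelled hypergraphs. -/
abbrev TT (m r n k : ℕ) : Type :=
  (E : {E // E ∈ HF r n k}) × (π : Fin m ≃ {e // e ∈ E.1}) × (∀ e, Fin r ≃ {v // v ∈ (π e).1})

/-- The assignment of a labelled hypergraph. -/
def FF (T : TT m r n k) : Fin m × Fin r → Fin n := fun s => (T.2.2 s.1 s.2).1

lemma es_FF (T : TT m r n k) (e : Fin m) : es (FF T) e = (T.2.1 e).1 := by
  ext v
  simp only [es, FF, Finset.mem_image, Finset.mem_univ, true_and]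
  constructor
  · rintro ⟨i, rfl⟩
    exact (T.2.2 e i).2
  · intro hv
    exact ⟨(T.2.2 e).symm ⟨v, hv⟩, by simp⟩

lemma FF_inj : Function.Injective (FF : TT m r n k → _) := by
  rintro ⟨⟨E, hE⟩, π, ρ⟩ ⟨⟨E', hE'⟩, π', ρ'⟩ h
  have h1 : ∀ e, (π e).1 = (π' e).1 := by
    intro e
    have a1 := es_FF ⟨⟨E, hE⟩, π, ρ⟩ e
    have a2 := es_FF ⟨⟨E', hE'⟩, π', ρ'⟩ e
    rw [h, a2] at a1
    exact a1.symm
  have hEE : E = E' := by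
    ext x
    constructor
    · intro hx
      have := (π' (π.symm ⟨x, hx⟩)).2
      rw [← h1] at this
      simpa using this
    · intro hx
      have := (π (π'.symm ⟨x, hx⟩)).2
      rw [h1] at this
      simpa using this
  subst hEE
  have hπ : π = π' := by
    ext1 e
    exact Subtype.ext (h1 e)
  subst hπ
  have hρ : ρ = ρ' := by
    funext e
    ext1 i
    exact Subtype.ext (congrFun h (e, i))
  subst hρ
  rfl

lemma FF_mem (T : TT m r n k) : FF T ∈ Sim m r n k := by
  have hes := es_FF T
  have hinj : ∀ x y : Fin m × Fin r, x.1 = y.1 → FF T x = FF T y → x = y := by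
    rintro ⟨e, i⟩ ⟨e', j⟩ h1 h2
    simp only at h1
    subst h1
    have : i = j := (T.2.2 e).injective (Subtype.ext h2)
    rw [this]
  have hH := T.1.2
  simp only [HF, Finset.mem_filter, Finset.mem_univ, true_and] at hH
  simp only [Sim, AP, Xs, Finset.mem_filter, Finset.mem_univ, true_and]
  refine ⟨⟨?_, ?_⟩, ?_⟩
  · intro v
    refine Eq.trans ?_ (hH.2 v)
    apply Finset.card_bij (fun s _ => (T.2.1 s.1).1)
    · intro s hs
      simp only [Finset.mem_filter, Finset.mem_univ, true_and] at hs ⊢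
      refine ⟨(T.2.1 s.1).2, ?_⟩
      rw [← hs]
      exact (T.2.2 s.1 s.2).2
    · intro s hs t ht h
      simp only [Finset.mem_filter, Finset.mem_univ, true_and] at hs ht
      exact hinj s t (T.2.1.injective (Subtype.ext h)) (hs.trans ht.symm)
    · intro e he
      simp only [Finset.mem_filter] at he
      obtain ⟨e0, he0⟩ := T.2.1.surjective ⟨e, he.1⟩
      have hv : v ∈ (T.2.1 e0).1 := by rw [he0]; exact he.2
      refine ⟨(e0, (T.2.2 e0).symm ⟨v, hv⟩), ?_, ?_⟩
      · rw [Finset.mem_filter]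
        refine ⟨Finset.mem_univ _, ?_⟩
        change ((T.2.2 e0) ((T.2.2 e0).symm ⟨v, hv⟩)).1 = v
        rw [Equiv.apply_symm_apply]
      · simp [he0]
  · intro x _ y _ h1 h2 h3
    exact h2 (hinj x y h1 h3)
  · intro e e' hne h
    rw [hes, hes] at h
    exact hne (T.2.1.injective (Subtype.ext h))

lemma FF_surj {f : Fin m × Fin r → Fin n} (hf : f ∈ Sim m r n k) :
    ∃ T : TT m r n k, FF T = f := by
  simp only [Sim, AP, Finset.mem_filter, Finset.mem_univ, true_and] at hf
  obtain ⟨⟨hX, hP⟩, hD⟩ := hf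
  have hinj : ∀ e, Function.Injective (fun i => f (e, i)) := by
    intro e i j hij
    by_contra hne
    exact hP (e, i) trivial (e, j) trivial rfl (by simpa using hne) hij
  have hesinj : Function.Injective (es f) := by
    intro e e' h
    by_contra hne
    exact hD e e' hne h
  have hE : Finset.univ.image (es f) ∈ HF r n k := by
    simp only [HF, Finset.mem_filter, Finset.mem_univ, true_and]
    constructor
    · intro e he
      simp only [Finset.mem_image, Finset.mem_univ, true_and] at he
      obtain ⟨e0, rfl⟩ := he
      unfold es
      rw [Finset.card_image_of_injective _ (hinj e0)]
      simp
    · intro v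
      rw [← fiber hX v]
      symm
      apply Finset.card_bij (fun s _ => es f s.1)
      · intro s hs
        simp only [Finset.mem_filter, Finset.mem_univ, true_and, Finset.mem_image] at hs ⊢
        refine ⟨⟨s.1, rfl⟩, ?_⟩
        simp only [es, Finset.mem_image, Finset.mem_univ, true_and]
        exact ⟨s.2, hs⟩
      · rintro ⟨e, i⟩ hs ⟨e', j⟩ ht h
        simp only [Finset.mem_filter, Finset.mem_univ, true_and] at hs ht
        have h1 : e = e' := hesinj h
        subst h1
        have : i = j := hinj e (hs.trans ht.symm)
        rw [this]
      · intro e he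
        simp only [Finset.mem_filter, Finset.mem_univ, true_and, Finset.mem_image] at he
        obtain ⟨⟨e0, rfl⟩, hv⟩ := he
        simp only [es, Finset.mem_image, Finset.mem_univ, true_and] at hv
        obtain ⟨i, hi⟩ := hv
        exact ⟨(e0, i), by simpa using hi, rfl⟩
  let π : Fin m ≃ {e // e ∈ Finset.univ.image (es f)} :=
    Equiv.ofBijective (fun e => ⟨es f e, by simp⟩) ⟨by
      intro e e' h
      exact hesinj (by simpa using h), by
      rintro ⟨e, he⟩
      simp only [Finset.mem_image, Finset.mem_univ, true_and] at he
      obtain ⟨e0, rfl⟩ := he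
      exact ⟨e0, rfl⟩⟩
  let ρ : ∀ e, Fin r ≃ {v // v ∈ (π e).1} := fun e =>
    Equiv.ofBijective (fun i => ⟨f (e, i), by
      change f (e, i) ∈ es f e
      simp [es]⟩) ⟨by
      intro i j h
      exact hinj e (by simpa using h), by
      rintro ⟨v, hv⟩
      change v ∈ es f e at hv
      simp only [es, Finset.mem_image, Finset.mem_univ, true_and] at hv
      obtain ⟨i, hi⟩ := hv
      exact ⟨i, Subtype.ext hi⟩⟩
  exact ⟨⟨⟨_, hE⟩, π, ρ⟩, rfl⟩

lemma card_Sim (hr : 0 < r) (hM : m * r = k * n) :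
    (Sim m r n k).card =
      Hcount r (fun _ : Fin n => k) * (Nat.factorial m * (Nat.factorial r) ^ m) := by
  have h1 : (Sim m r n k).card = Fintype.card (TT m r n k) := by
    rw [← Fintype.card_coe]
    symm
    apply Fintype.card_congr
    refine Equiv.ofBijective (fun T => (⟨FF T, FF_mem T⟩ : {f // f ∈ Sim m r n k})) ⟨?_, ?_⟩
    · intro T T' h
      exact FF_inj (by simpa using h)
    · rintro ⟨f, hf⟩
      obtain ⟨T, hT⟩ := FF_surj hf
      exact ⟨T, Subtype.ext hT⟩
  rw [h1, Fintype.card_sigma]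
  have h2 : ∀ E : {E // E ∈ HF r n k}, Fintype.card ((π : Fin m ≃ {e // e ∈ E.1}) ×
      (∀ e, Fin r ≃ {v // v ∈ (π e).1})) = Nat.factorial m * (Nat.factorial r) ^ m := by
    intro E
    rw [Fintype.card_sigma]
    have h3 : ∀ π : Fin m ≃ {e // e ∈ E.1}, Fintype.card (∀ e, Fin r ≃ {v // v ∈ (π e).1}) =
        (Nat.factorial r) ^ m := by
      intro π
      rw [Fintype.card_pi]
      have h4 : ∀ e, Fintype.card (Fin r ≃ {v // v ∈ (π e).1}) = Nat.factorial r := by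
        intro e
        have hE := E.2
        simp only [HF, Finset.mem_filter, Finset.mem_univ, true_and] at hE
        rw [Fintype.card_equiv (Fintype.equivOfCardEq (by
          rw [Fintype.card_coe, hE.1 _ (π e).2, Fintype.card_fin]))]
        simp
      rw [Finset.prod_congr rfl (fun e _ => h4 e)]
      simp
    rw [Finset.sum_congr rfl (fun π _ => h3 π), Finset.sum_const, smul_eq_mul, Finset.card_univ,
      Fintype.card_equiv (Fintype.equivOfCardEq (by
        rw [Fintype.card_coe, card_of_HF hr hM E.2, Fintype.card_fin]))]
    simp
  rw [Finset.sum_congr rfl (fun E _ => h2 E), Finset.sum_const, smul_eq_mul, Finset.card_univ,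
    Fintype.card_coe, HF_card]

lemma triple (hk : 2 ≤ k) (hr : 1 ≤ r) (hM : m * r = k * n) (hn : 20 * r ≤ n)
    (a0 a1 a2 b0 b1 b2 : Fin m × Fin r)
    (h0 : b0 ∉ ({a0, a1, a2} : Finset (Fin m × Fin r)))
    (h1 : b1 ∉ ({a0, a1, a2} : Finset (Fin m × Fin r)))
    (h2 : b2 ∉ ({a0, a1, a2} : Finset (Fin m × Fin r)))
    (h01 : b0 ≠ b1) (h02 : b0 ≠ b2) (h12 : b1 ≠ b2) :
    (((AP m r n k Finset.univ).filter fun f =>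
      ((True ∧ f a0 = f b0) ∧ f a1 = f b1) ∧ f a2 = f b2).card : ℝ) ≤
      ((AP m r n k Finset.univ).card : ℝ) * (2 / n) ^ 3 := by
  simp only [Finset.mem_insert, Finset.mem_singleton, not_or] at h0 h1 h2
  have hinv : ∀ (f : Fin m × Fin r → Fin n) (b g x y : Fin m × Fin r), x ≠ b → y ≠ b → x ≠ g →
      y ≠ g → f x = f y → (f ∘ Equiv.swap b g) x = (f ∘ Equiv.swap b g) y := by
    intro f b g x y q1 q2 q3 q4 h
    simp only [Function.comp_apply]
    rw [Equiv.swap_apply_of_ne_of_ne q1 q3, Equiv.swap_apply_of_ne_of_ne q2 q4, h]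
  have s0 := upper_real hk hr hM hn Finset.univ {a0} (fun _ => True) a0 b0 (by simp)
    (by simp [h0]) (by simp) (fun _ _ _ _ => trivial)
  have s1 := upper_real hk hr hM hn Finset.univ {a0, b0, a1} (fun f => True ∧ f a0 = f b0) a1 b1
    (by simp) (by simp [h1, h01.symm]) (Finset.card_le_three.trans (by norm_num)) (by
      intro f g hg hf
      simp only [Finset.mem_insert, Finset.mem_singleton, not_or] at hg
      exact ⟨trivial, hinv f b1 g a0 b0 (Ne.symm h1.1) h01 (Ne.symm hg.1) (Ne.symm hg.2.1) hf.2⟩)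
  have s2 := upper_real hk hr hM hn Finset.univ {a0, b0, a1, b1, a2}
    (fun f => (True ∧ f a0 = f b0) ∧ f a1 = f b1) a2 b2
    (by simp) (by simp [h2, h02.symm, h12.symm]) Finset.card_le_five (by
      intro f g hg hf
      simp only [Finset.mem_insert, Finset.mem_singleton, not_or] at hg
      exact ⟨⟨trivial, hinv f b2 g a0 b0 (Ne.symm h2.1) h02 (Ne.symm hg.1) (Ne.symm hg.2.1) hf.1.2⟩,
        hinv f b2 g a1 b1 (Ne.symm h2.2.1) h12 (Ne.symm hg.2.2.1) (Ne.symm hg.2.2.2.1) hf.2⟩)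
  have hn0 : (0 : ℝ) ≤ 2 / n := by positivity
  have t2 : (((AP m r n k Finset.univ).filter fun f =>
      ((True ∧ f a0 = f b0) ∧ f a1 = f b1) ∧ f a2 = f b2).card : ℝ) ≤
      (((AP m r n k Finset.univ).filter fun f =>
        (True ∧ f a0 = f b0) ∧ f a1 = f b1).card : ℝ) * (2 / n) := by convert s2
  have t1 : (((AP m r n k Finset.univ).filter fun f =>
      (True ∧ f a0 = f b0) ∧ f a1 = f b1).card : ℝ) ≤
      (((AP m r n k Finset.univ).filter fun f => True ∧ f a0 = f b0).card : ℝ) * (2 / n) := by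
    convert s1
  have t0 : (((AP m r n k Finset.univ).filter fun f => True ∧ f a0 = f b0).card : ℝ) ≤
      ((AP m r n k Finset.univ).card : ℝ) * (2 / n) := by
    rw [Finset.filter_true] at s0
    convert s0
  refine (t2.trans (mul_le_mul_of_nonneg_right
    (t1.trans (mul_le_mul_of_nonneg_right t0 hn0)) hn0)).trans (le_of_eq ?_)
  ring

lemma sim_bound (hk : 2 ≤ k) (hr : 3 ≤ r) (hM : m * r = k * n) (hn : 20 * r ≤ n) :
    ((AP m r n k Finset.univ).card : ℝ) * (1 - 8 * r * (k : ℝ) ^ 2 / n) ≤ (Sim m r n k).card := by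
  let i0 : Fin r := ⟨0, by omega⟩
  let i1 : Fin r := ⟨1, by omega⟩
  let i2 : Fin r := ⟨2, by omega⟩
  let I : Finset ((Fin m × Fin m) × (Fin r × Fin r × Fin r)) :=
    Finset.univ.filter fun p => p.1.1 ≠ p.1.2
  let D : ((Fin m × Fin m) × (Fin r × Fin r × Fin r)) → Finset (Fin m × Fin r → Fin n) := fun p =>
    (AP m r n k Finset.univ).filter fun f =>
      ((True ∧ f (p.1.2, p.2.1) = f (p.1.1, i0)) ∧ f (p.1.2, p.2.2.1) = f (p.1.1, i1)) ∧
        f (p.1.2, p.2.2.2) = f (p.1.1, i2)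
  have hsub : AP m r n k Finset.univ ⊆ Sim m r n k ∪ I.biUnion D := by
    intro f hf
    rw [Finset.mem_union]
    by_cases h : f ∈ Sim m r n k
    · exact Or.inl h
    · right
      simp only [Sim, Finset.mem_filter, hf, true_and] at h
      push Not at h
      obtain ⟨e, e', hne, hee⟩ := h
      have hex : ∀ i, ∃ j, f (e', j) = f (e, i) := by
        intro i
        have h1 : f (e, i) ∈ es f e := by simp [es]
        rw [hee] at h1
        simpa [es] using h1
      obtain ⟨j0, hj0⟩ := hex i0
      obtain ⟨j1, hj1⟩ := hex i1
      obtain ⟨j2, hj2⟩ := hex i2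
      rw [Finset.mem_biUnion]
      refine ⟨((e, e'), (j0, j1, j2)), by simpa [I] using hne, ?_⟩
      simp only [D, Finset.mem_filter]
      exact ⟨hf, ⟨⟨trivial, hj0⟩, hj1⟩, hj2⟩
  have hcard : (AP m r n k Finset.univ).card ≤ (Sim m r n k).card + ∑ p ∈ I, (D p).card :=
    (Finset.card_le_card hsub).trans ((Finset.card_union_le _ _).trans
      (Nat.add_le_add_left Finset.card_biUnion_le _))
  have hD : ∀ p ∈ I, ((D p).card : ℝ) ≤ ((AP m r n k Finset.univ).card : ℝ) * (2 / n) ^ 3 := by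
    rintro ⟨⟨e, e'⟩, j0, j1, j2⟩ hp
    have hne : e ≠ e' := by simpa [I] using hp
    exact triple hk (by omega) hM hn (e', j0) (e', j1) (e', j2) (e, i0) (e, i1) (e, i2)
      (by simp [hne]) (by simp [hne]) (by simp [hne]) (by simp [i0, i1]) (by simp [i0, i2])
      (by simp [i1, i2])
  have hI : (I.card : ℝ) ≤ (m : ℝ) ^ 2 * (r : ℝ) ^ 3 := by
    have : I.card ≤ m ^ 2 * r ^ 3 := by
      refine (Finset.card_le_univ _).trans ?_
      simp only [Fintype.card_prod, Fintype.card_fin]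
      exact le_of_eq (by ring)
    exact_mod_cast this
  have hn0 : (0 : ℝ) < n := by
    have : 0 < n := by omega
    exact_mod_cast this
  have hsum : ∑ p ∈ I, ((D p).card : ℝ) ≤
      ((AP m r n k Finset.univ).card : ℝ) * (8 * r * (k : ℝ) ^ 2 / n) := by
    refine (Finset.sum_le_sum hD).trans ?_
    rw [Finset.sum_const, nsmul_eq_mul]
    have hA0 : (0 : ℝ) ≤ ((AP m r n k Finset.univ).card : ℝ) * (2 / n) ^ 3 :=
      mul_nonneg (Nat.cast_nonneg _) (by positivity)
    refine (mul_le_mul_of_nonneg_right hI hA0).trans (le_of_eq ?_)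
    have hMR : (m : ℝ) * r = k * n := by exact_mod_cast hM
    have e : (m : ℝ) ^ 2 * (r : ℝ) ^ 3 = (k * n) ^ 2 * r := by rw [← hMR]; ring
    rw [e]
    field_simp
    norm_num
  have hcR : ((AP m r n k Finset.univ).card : ℝ) ≤
      (Sim m r n k).card + ∑ p ∈ I, ((D p).card : ℝ) := by exact_mod_cast hcard
  linarith

lemma final (hk : 2 ≤ k) (hr : 3 ≤ r) (hM : m * r = k * n)
    (hδ : (k : ℝ) ^ 2 ≤ 1 / (20 * r) * n) :
    0 < (Sim m r n k).card ∧ 0 < (Xs m r n k).card ∧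
    |Real.log ((Sim m r n k).card : ℝ) - Real.log ((Xs m r n k).card : ℝ) +
      (1 / 2 : ℝ) * ((k : ℝ) - 1) * ((r : ℝ) - 1)| ≤ (30 * (r : ℝ) ^ 2) * (k : ℝ) ^ 2 / n := by
  have hkR : (2 : ℝ) ≤ k := by exact_mod_cast hk
  have hrR : (3 : ℝ) ≤ r := by exact_mod_cast hr
  have hMR : (m : ℝ) * r = k * n := by exact_mod_cast hM
  have h1 : 20 * (r : ℝ) * (k : ℝ) ^ 2 ≤ n := by
    have h : 1 / (20 * (r : ℝ)) * n = n / (20 * r) := by ring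
    rw [h, le_div_iff₀ (by positivity)] at hδ
    linarith
  have hk2 : (4 : ℝ) ≤ (k : ℝ) ^ 2 := by nlinarith
  have h2 : 20 * (r : ℝ) ≤ n := by nlinarith
  have hn : 20 * r ≤ n := by exact_mod_cast h2
  have hn0 : (0 : ℝ) < n := by linarith
  have hX : 0 < (Xs m r n k).card := by
    apply Nat.pos_of_ne_zero
    intro h
    have := card_Xs (n := n) (k := k) hM
    rw [h, zero_mul] at this
    exact (Nat.factorial_ne_zero _) this.symm
  obtain ⟨hA, hlog⟩ := main_induct hk (by omega) hM hn hX Finset.univ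
  have hsb := sim_bound hk hr hM hn
  have hle : (Sim m r n k).card ≤ (AP m r n k Finset.univ).card :=
    Finset.card_le_card (Finset.filter_subset _ _)
  rw [phi_univ, Finset.card_univ, Fintype.card_prod, Fintype.card_fin, Fintype.card_fin, hM] at hlog
  have e1 : ((k * n * (r - 1) : ℕ) : ℝ) * (((k : ℝ) - 1) / (2 * (k * n))) =
      (1 / 2 : ℝ) * ((k : ℝ) - 1) * ((r : ℝ) - 1) := by
    rw [Nat.cast_mul, Nat.cast_sub (by omega)]
    push_cast
    field_simp
  have e2 : ((k * n : ℕ) : ℝ) * (14 * (r : ℝ) ^ 2 / (n : ℝ) ^ 2) = 14 * (r : ℝ) ^ 2 * k / n := by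
    push_cast
    field_simp
  rw [e1, e2] at hlog
  have hAR : (0 : ℝ) < (AP m r n k Finset.univ).card := by exact_mod_cast hA
  have hleR : ((Sim m r n k).card : ℝ) ≤ (AP m r n k Finset.univ).card := by exact_mod_cast hle
  generalize ((AP m r n k Finset.univ).card : ℝ) = A at *
  obtain ⟨y, hy⟩ : ∃ y, y = 8 * (r : ℝ) * (k : ℝ) ^ 2 / n := ⟨_, rfl⟩
  have hy0 : 0 ≤ y := by rw [hy]; positivity
  have hy1 : y ≤ 1 / 2 := by rw [hy, div_le_iff₀ hn0]; linarith
  rw [← hy] at hsb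
  have hS : (0 : ℝ) < (Sim m r n k).card := lt_of_lt_of_le (mul_pos hAR (by linarith)) hsb
  refine ⟨by exact_mod_cast hS, hX, ?_⟩
  have l1 : Real.log ((Sim m r n k).card : ℝ) ≤ Real.log A := Real.log_le_log hS hleR
  have l2 : Real.log A - 2 * y ≤ Real.log ((Sim m r n k).card : ℝ) := by
    have h3 := Real.log_le_log (mul_pos hAR (by linarith : (0 : ℝ) < 1 - y)) hsb
    rw [Real.log_mul hAR.ne' (by linarith)] at h3
    have h4 := Real.one_sub_inv_le_log_of_pos (by linarith : (0 : ℝ) < 1 - y)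
    have h5 : -(2 * y) ≤ 1 - (1 - y)⁻¹ := by
      have h6 : (1 - y)⁻¹ ≤ 1 + 2 * y := by
        rw [inv_le_iff_one_le_mul₀ (by linarith)]
        nlinarith
      linarith
    linarith
  have hbd : 14 * (r : ℝ) ^ 2 * k / n + 2 * y ≤ (30 * (r : ℝ) ^ 2) * (k : ℝ) ^ 2 / n := by
    rw [hy, ← mul_div_assoc, ← add_div]
    apply div_le_div_of_nonneg_right _ hn0.le
    have g1 : (r : ℝ) ^ 2 * k ≤ (r : ℝ) ^ 2 * (k : ℝ) ^ 2 := by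
      apply mul_le_mul_of_nonneg_left _ (by positivity)
      nlinarith
    have g2 : (r : ℝ) * (k : ℝ) ^ 2 ≤ (r : ℝ) ^ 2 * (k : ℝ) ^ 2 := by
      apply mul_le_mul_of_nonneg_right _ (by positivity)
      nlinarith
    linarith
  rw [abs_le] at hlog ⊢
  constructor <;> linarith [hlog.1, hlog.2]

end RHE

/-- asymptotic enumeration of k-regular simple r-uniform
hypergraphs (Corollary 2 of the paper). -/
theorem regular_hypergraph_enumeration (r : ℕ) (hr : 3 ≤ r) :
    ∃ C δ : ℝ, 0 < C ∧ 0 < δ ∧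
      ∀ (n kk : ℕ), 2 ≤ kk → (kk : ℝ) ^ 2 ≤ δ * (n : ℝ) → r ∣ kk * n →
        ∃ E : ℝ, |E| ≤ C * (kk : ℝ) ^ 2 / (n : ℝ) ∧
          (Hcount r (fun _ : Fin n => kk) : ℝ) =
            (Nat.factorial (kk * n) : ℝ) /
                ((Nat.factorial (kk * n / r) : ℝ) * (Nat.factorial r : ℝ) ^ (kk * n / r) *
                  (Nat.factorial kk : ℝ) ^ n) *
              Real.exp (-(1 / 2 : ℝ) * ((kk : ℝ) - 1) * ((r : ℝ) - 1) + E) := by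
  have hr0 : (0 : ℝ) < r := by
    have : 0 < r := by omega
    exact_mod_cast this
  refine ⟨30 * (r : ℝ) ^ 2, 1 / (20 * r), by positivity, by positivity, ?_⟩
  intro n kk hk hδ hdvd
  have hM : (kk * n / r) * r = kk * n := Nat.div_mul_cancel hdvd
  generalize kk * n / r = m at hM ⊢
  obtain ⟨hS, hX, hE⟩ := RHE.final hk hr hM hδ
  refine ⟨_, hE, ?_⟩
  have hSR : (0 : ℝ) < (RHE.Sim m r n kk).card := by exact_mod_cast hS
  have hXR : (0 : ℝ) < (RHE.Xs m r n kk).card := by exact_mod_cast hX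
  have c1 : ((RHE.Xs m r n kk).card : ℝ) * (Nat.factorial kk : ℝ) ^ n =
      (Nat.factorial (kk * n) : ℝ) := by exact_mod_cast RHE.card_Xs hM
  have c2 : ((RHE.Sim m r n kk).card : ℝ) = (Hcount r (fun _ : Fin n => kk) : ℝ) *
      ((Nat.factorial m : ℝ) * (Nat.factorial r : ℝ) ^ m) := by
    exact_mod_cast RHE.card_Sim (by omega) hM
  have e : -(1 / 2 : ℝ) * ((kk : ℝ) - 1) * ((r : ℝ) - 1) +
      (Real.log ((RHE.Sim m r n kk).card : ℝ) - Real.log ((RHE.Xs m r n kk).card : ℝ) +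
      (1 / 2 : ℝ) * ((kk : ℝ) - 1) * ((r : ℝ) - 1)) =
      Real.log ((RHE.Sim m r n kk).card : ℝ) - Real.log ((RHE.Xs m r n kk).card : ℝ) := by ring
  rw [e, Real.exp_sub, Real.exp_log hSR, Real.exp_log hXR, ← c1, c2]
  have f1 : (Nat.factorial m : ℝ) ≠ 0 := by exact_mod_cast Nat.factorial_ne_zero m
  have f2 : (Nat.factorial r : ℝ) ≠ 0 := by exact_mod_cast Nat.factorial_ne_zero r
  have f3 : (Nat.factorial kk : ℝ) ≠ 0 := by exact_mod_cast Nat.factorial_ne_zero kk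
  have f4 := hXR.ne'
  field_simp
end

section
/- Let r ≥ 2, let B be a set of M points partitioned into cells B_1,…,B_n with |B_i| = k_i, with r dividing M, and let U_1,…,U_c be fixed pairwise disjoint r-subsets of B with c ≤ M/r. Then the probability that a uniformly random partition Q ∈ Λ_r(k) contains all of U_1,…,U_c as parts equals exactly (r!)^c · (M/r)(M/r − 1)⋯(M/r − c + 1) / (M(M−1)⋯(M−rc+1)). Moreover there is an absolute constant C such that if r^2c^2 ≤ M/2 this probability equals (((r−1)!)^c / M^{c(r−1)}) · exp(E) with |E| ≤ C·r^2c^2/M. -/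
open scoped Classical BigOperators

/-- `Q` is a partition of the finset `S` into parts of size `r`. -/
def IsPart {α : Type*} (r : ℕ) (S : Finset α) (Q : Finset (Finset α)) : Prop :=
  (∀ U ∈ Q, U.card = r ∧ U ⊆ S) ∧ ∀ p ∈ S, ∃! U, U ∈ Q ∧ p ∈ U

/-- The finset of partitions of `S` into parts of size `r`. -/
noncomputable def parts {α : Type*} [DecidableEq α] (r : ℕ) (S : Finset α) :
    Finset (Finset (Finset α)) :=
  S.powerset.powerset.filter fun Q => IsPart r S Q

theorem mem_parts {α : Type*} [DecidableEq α] {r : ℕ} {S : Finset α} {Q : Finset (Finset α)} :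
    Q ∈ parts r S ↔ IsPart r S Q := by
  unfold parts
  rw [Finset.mem_filter, Finset.mem_powerset]
  refine ⟨fun h => h.2, fun h => ⟨fun U hU => ?_, h⟩⟩
  exact Finset.mem_powerset.2 (h.1 U hU).2

theorem IsPart.disj {α : Type*} {r : ℕ} {S : Finset α} {Q : Finset (Finset α)}
    (h : IsPart r S Q) {U W : Finset α} (hU : U ∈ Q) (hW : W ∈ Q) {p : α} (hp : p ∈ U)
    (hp' : p ∈ W) : U = W :=
  (h.2 p ((h.1 U hU).2 hp)).unique ⟨hU, hp⟩ ⟨hW, hp'⟩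

theorem IsPart.card {α : Type*} [DecidableEq α] {r : ℕ} {S : Finset α} {Q : Finset (Finset α)}
    (h : IsPart r S Q) : S.card = r * Q.card := by
  have hS : S = Q.biUnion id := by
    ext p
    simp only [Finset.mem_biUnion, id]
    constructor
    · intro hp
      obtain ⟨U, hU, -⟩ := h.2 p hp
      exact ⟨U, hU⟩
    · rintro ⟨U, hU, hp⟩
      exact (h.1 U hU).2 hp
  rw [hS, Finset.card_biUnion]
  · rw [mul_comm]
    exact Finset.sum_const_nat (fun U hU => (h.1 U hU).1)
  · intro U hU W hW hne
    show Disjoint U W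
    rw [Finset.disjoint_left]
    intro p hp hp'
    exact hne (h.disj hU hW hp hp')

theorem card_filter_subset {α : Type*} [DecidableEq α] {r : ℕ} (hr : 0 < r) (S : Finset α)
    (T : Finset (Finset α)) (hT : ∀ U ∈ T, U.card = r ∧ U ⊆ S)
    (hd : ∀ U ∈ T, ∀ W ∈ T, ∀ p, p ∈ U → p ∈ W → U = W) :
    ((parts r S).filter fun Q => T ⊆ Q).card = (parts r (S \ T.biUnion id)).card := by
  refine Finset.card_bij' (fun Q _ => Q \ T) (fun Q _ => Q ∪ T) ?_ ?_ ?_ ?_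
  · intro Q hQ
    rw [Finset.mem_filter, mem_parts] at hQ
    obtain ⟨hQ, hTQ⟩ := hQ
    rw [mem_parts]
    refine ⟨fun U hU => ?_, fun p hp => ?_⟩
    · rw [Finset.mem_sdiff] at hU
      refine ⟨(hQ.1 U hU.1).1, fun p hp => ?_⟩
      rw [Finset.mem_sdiff, Finset.mem_biUnion]
      refine ⟨(hQ.1 U hU.1).2 hp, ?_⟩
      rintro ⟨W, hW, hpW⟩
      have := hQ.disj hU.1 (hTQ hW) hp hpW
      exact hU.2 (this ▸ hW)
    · rw [Finset.mem_sdiff, Finset.mem_biUnion] at hp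
      obtain ⟨U, hU, huniq⟩ := hQ.2 p hp.1
      refine ⟨U, ⟨Finset.mem_sdiff.2 ⟨hU.1, fun h => hp.2 ⟨U, h, hU.2⟩⟩, hU.2⟩, ?_⟩
      rintro W ⟨hW, hpW⟩
      exact huniq W ⟨(Finset.mem_sdiff.1 hW).1, hpW⟩
  · intro Q hQ
    rw [mem_parts] at hQ
    rw [Finset.mem_filter, mem_parts]
    refine ⟨⟨fun U hU => ?_, fun p hp => ?_⟩, Finset.subset_union_right⟩
    · rcases Finset.mem_union.1 hU with h | h
      · exact ⟨(hQ.1 U h).1, (hQ.1 U h).2.trans Finset.sdiff_subset⟩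
      · exact hT U h
    · by_cases hpT : p ∈ T.biUnion id
      · obtain ⟨U, hU, hpU⟩ := Finset.mem_biUnion.1 hpT
        refine ⟨U, ⟨Finset.mem_union_right _ hU, hpU⟩, ?_⟩
        rintro W ⟨hW, hpW⟩
        rcases Finset.mem_union.1 hW with h | h
        · exact absurd hpT (Finset.mem_sdiff.1 ((hQ.1 W h).2 hpW)).2
        · exact hd W h U hU p hpW hpU
      · obtain ⟨U, hU, huniq⟩ := hQ.2 p (Finset.mem_sdiff.2 ⟨hp, hpT⟩)
        refine ⟨U, ⟨Finset.mem_union_left _ hU.1, hU.2⟩, ?_⟩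
        rintro W ⟨hW, hpW⟩
        rcases Finset.mem_union.1 hW with h | h
        · exact huniq W ⟨h, hpW⟩
        · exact absurd (Finset.mem_biUnion.2 ⟨W, h, hpW⟩) hpT
  · intro Q hQ
    exact Finset.sdiff_union_of_subset (Finset.mem_filter.1 hQ).2
  · intro Q hQ
    rw [mem_parts] at hQ
    show (Q ∪ T) \ T = Q
    rw [Finset.union_sdiff_right, Finset.sdiff_eq_self_iff_disjoint, Finset.disjoint_left]
    intro U hU hUT
    have hne : U.Nonempty := by
      rw [← Finset.card_pos, (hT U hUT).1]; exact hr
    obtain ⟨p, hp⟩ := hne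
    exact (Finset.mem_sdiff.1 ((hQ.1 U hU).2 hp)).2 (Finset.mem_biUnion.2 ⟨U, hUT, hp⟩)

theorem card_parts {α : Type*} [DecidableEq α] {r : ℕ} (hr : 0 < r) (m : ℕ) :
    ∀ S : Finset α, S.card = r * m →
      (parts r S).card * (m.factorial * r.factorial ^ m) = (r * m).factorial := by
  induction m with
  | zero =>
    intro S hS
    have hS : S = ∅ := by simpa using hS
    subst hS
    have : parts r (∅ : Finset α) = {∅} := by
      ext Q
      rw [mem_parts, Finset.mem_singleton]
      constructor
      · intro h
        have := h.card
        simp only [Finset.card_empty] at this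
        rcases Nat.mul_eq_zero.1 this.symm with h | h
        · omega
        · exact Finset.card_eq_zero.1 h
      · rintro rfl
        exact ⟨by simp, by simp⟩
    simp [this]
  | succ m ih =>
    intro S hS
    have key : (parts r S).card * (m + 1) * (m.factorial * r.factorial ^ m)
        = (r * (m + 1)).choose r * (r * m).factorial := by
      have h1 : (parts r S).card * (m + 1) =
          ∑ Q ∈ parts r S, ((Finset.powersetCard r S).filter fun U => U ∈ Q).card := by
        rw [Finset.sum_const_nat (m := m + 1)]
        intro Q hQ
        rw [mem_parts] at hQ
        have : (Finset.powersetCard r S).filter (fun U => U ∈ Q) = Q := by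
          ext U
          rw [Finset.mem_filter, Finset.mem_powersetCard]
          exact ⟨fun h => h.2, fun h => ⟨(hQ.1 U h).symm, h⟩⟩
        rw [this]
        have h2 := hQ.card
        rw [hS] at h2
        exact (Nat.eq_of_mul_eq_mul_left hr h2).symm
      have h2 := Finset.sum_card_bipartiteAbove_eq_sum_card_bipartiteBelow
        (s := parts r S) (t := Finset.powersetCard r S) (fun Q U => U ∈ Q)
      unfold Finset.bipartiteAbove Finset.bipartiteBelow at h2
      rw [h1, h2, Finset.sum_mul, Finset.sum_congr rfl (g := fun _ => (r * m).factorial)]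
      · simp [hS]
      · intro U hU
        rw [Finset.mem_powersetCard] at hU
        have h3 := card_filter_subset hr S {U} (by simpa using ⟨hU.2, hU.1⟩)
          (by simp)
        simp only [Finset.singleton_subset_iff, Finset.singleton_biUnion, id] at h3
        rw [h3]
        apply ih
        rw [Finset.card_sdiff_of_subset hU.1, hS, hU.2, Nat.mul_succ, Nat.add_sub_cancel]
    have h4 := Nat.choose_mul_factorial_mul_factorial (n := r * (m + 1)) (k := r)
      (Nat.le_mul_of_pos_right r (Nat.succ_pos m))
    have h5 : r * (m + 1) - r = r * m := by rw [Nat.mul_succ, Nat.add_sub_cancel]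
    rw [h5] at h4
    rw [← h4, Nat.factorial_succ, pow_succ]
    calc _ = (parts r S).card * (m + 1) * (m.factorial * r.factorial ^ m) * r.factorial := by ring
      _ = _ := by rw [key]; ring

theorem desc_asymp (N : ℕ) (hN : 0 < N) (d : ℕ) : 2 * d ≤ N →
    ∃ E : ℝ, |E| ≤ 2 * (d : ℝ) ^ 2 / N ∧ (N.descFactorial d : ℝ) = (N : ℝ) ^ d * Real.exp E := by
  have hN' : (0 : ℝ) < N := by exact_mod_cast hN
  induction d with
  | zero => intro _; exact ⟨0, by simp, by simp⟩
  | succ d ih =>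
    intro hd
    obtain ⟨E, hE, hE'⟩ := ih (by omega)
    have hd' : 2 * ((d : ℝ) + 1) ≤ N := by exact_mod_cast hd
    set x : ℝ := d / N with hx
    have hx0 : 0 ≤ x := by positivity
    have hx1 : x ≤ 1 / 2 := by rw [hx, div_le_iff₀ hN']; linarith
    have hpos : 0 < 1 - x := by linarith
    have hlog1 : Real.log (1 - x) ≤ 0 := Real.log_nonpos hpos.le (by linarith)
    have hlog2 : -(2 * x) ≤ Real.log (1 - x) := by
      have h := Real.one_sub_inv_le_log_of_pos hpos
      have : (1 - x)⁻¹ ≤ 1 + 2 * x := by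
        rw [inv_le_comm₀ hpos (by positivity), ← one_div, div_le_iff₀ (by positivity)]
        nlinarith
      linarith
    refine ⟨E + Real.log (1 - x), ?_, ?_⟩
    · calc |E + Real.log (1 - x)| ≤ |E| + |Real.log (1 - x)| := abs_add_le _ _
        _ ≤ 2 * (d : ℝ) ^ 2 / N + 2 * x := by
          gcongr
          rw [abs_of_nonpos hlog1]; linarith
        _ = (2 * (d : ℝ) ^ 2 + 2 * d) / N := by rw [hx]; ring
        _ ≤ _ := by
          push_cast
          gcongr
          nlinarith [(Nat.cast_nonneg d : (0 : ℝ) ≤ d)]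
    · rw [Nat.descFactorial_succ, Real.exp_add, Real.exp_log hpos, Nat.cast_mul, hE',
        Nat.cast_sub (by omega), hx]
      field_simp
      ring

theorem lam_eq {n : ℕ} (r : ℕ) (k : Fin n → ℕ) :
    Lam r k = (↑(parts r (Finset.univ : Finset (Pts k))) : Set (Finset (Finset (Pts k)))) := by
  ext Q
  rw [Finset.mem_coe, mem_parts]
  simp [Lam, IsPartition, IsPart]

theorem exact_part {n : ℕ} (r : ℕ) (k : Fin n → ℕ) (c : ℕ) (U : Fin c → Finset (Pts k))
    (hr : 2 ≤ r) (hdvd : r ∣ Mtot k) (hU : ∀ j, (U j).card = r)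
    (hdis : ∀ j j', j ≠ j' → Disjoint (U j) (U j')) (hc : c ≤ Mtot k / r) :
    (Set.ncard {Q ∈ Lam r k | ∀ j, U j ∈ Q} : ℝ) / (Set.ncard (Lam r k) : ℝ) =
            (Nat.factorial r : ℝ) ^ c * ((Mtot k / r).descFactorial c : ℝ) /
              ((Mtot k).descFactorial (r * c) : ℝ) := by
  have hr0 : 0 < r := by omega
  obtain ⟨m, hm⟩ := hdvd
  have hcard : (Finset.univ : Finset (Pts k)).card = Mtot k := by
    simp [Mtot]
  have hmr : Mtot k / r = m := by rw [hm, Nat.mul_div_cancel_left _ hr0]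
  rw [hmr] at hc ⊢
  set T : Finset (Finset (Pts k)) := Finset.univ.image U with hT
  have hset : {Q ∈ Lam r k | ∀ j, U j ∈ Q} =
      (↑((parts r (Finset.univ : Finset (Pts k))).filter fun Q => T ⊆ Q) :
        Set (Finset (Finset (Pts k)))) := by
    rw [lam_eq]
    ext Q
    simp [hT, Finset.image_subset_iff]
  have hTd : ∀ V ∈ T, ∀ W ∈ T, ∀ p, p ∈ V → p ∈ W → V = W := by
    intro V hV W hW p hp hp'
    obtain ⟨i, -, rfl⟩ := Finset.mem_image.1 hV
    obtain ⟨j, -, rfl⟩ := Finset.mem_image.1 hW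
    by_contra hne
    have : i ≠ j := fun h => hne (by rw [h])
    exact Finset.disjoint_left.1 (hdis i j this) hp hp'
  have hTc : ∀ V ∈ T, V.card = r ∧ V ⊆ Finset.univ := by
    intro V hV
    obtain ⟨i, -, rfl⟩ := Finset.mem_image.1 hV
    exact ⟨hU i, Finset.subset_univ _⟩
  have hbi : (T.biUnion id).card = r * c := by
    rw [hT, Finset.image_biUnion, Finset.card_biUnion]
    · simp [hU, mul_comm]
    · intro i _ j _ hij
      exact hdis i j hij
  rw [hset, lam_eq, Set.ncard_coe_finset, Set.ncard_coe_finset,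
    card_filter_subset hr0 _ T hTc hTd]
  have e1 := card_parts hr0 m (Finset.univ : Finset (Pts k)) (by rw [hcard, hm])
  have e2 := card_parts hr0 (m - c) ((Finset.univ : Finset (Pts k)) \ T.biUnion id) (by
    rw [Finset.card_sdiff_of_subset (Finset.subset_univ _), hcard, hm, hbi, Nat.mul_sub])
  have e3 := Nat.factorial_mul_descFactorial hc
  have e4 := Nat.factorial_mul_descFactorial (Nat.mul_le_mul_left r hc)
  rw [← Nat.mul_sub] at e4
  have e5 : r.factorial ^ m = r.factorial ^ (m - c) * r.factorial ^ c := by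
    rw [← pow_add, Nat.sub_add_cancel hc]
  rw [hm]
  generalize (parts r (Finset.univ : Finset (Pts k))).card = a at *
  generalize (parts r ((Finset.univ : Finset (Pts k)) \ T.biUnion id)).card = b at *
  have ha : a ≠ 0 := by
    rintro rfl
    rw [zero_mul] at e1
    exact Nat.factorial_ne_zero _ e1.symm
  have hd : (r * m).descFactorial (r * c) ≠ 0 := by
    intro h
    rw [h, mul_zero] at e4
    exact Nat.factorial_ne_zero _ e4.symm
  rw [div_eq_div_iff (by exact_mod_cast ha) (by exact_mod_cast hd)]
  norm_cast
  have hF : 0 < (m - c).factorial * r.factorial ^ (m - c) := by positivity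
  apply Nat.eq_of_mul_eq_mul_right hF
  calc _ = (b * ((m - c).factorial * r.factorial ^ (m - c))) * (r * m).descFactorial (r * c) := by
        ring
    _ = a * (m.factorial * r.factorial ^ m) := by rw [e2, e4, e1]
    _ = _ := by rw [e5, ← e3]; ring

/-- the probability that a uniformly random partition contains `c`
fixed disjoint parts (Lemma 1 of the paper, with an exact form). -/
theorem probability_contains_parts :
    ∃ C : ℝ, 0 < C ∧
      ∀ (r n : ℕ) (k : Fin n → ℕ) (c : ℕ) (U : Fin c → Finset (Pts k)),
        2 ≤ r → r ∣ Mtot k →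
        (∀ j, (U j).card = r) →
        (∀ j j', j ≠ j' → Disjoint (U j) (U j')) →
        c ≤ Mtot k / r →
        (Set.ncard {Q ∈ Lam r k | ∀ j, U j ∈ Q} : ℝ) / (Set.ncard (Lam r k) : ℝ) =
            (Nat.factorial r : ℝ) ^ c * ((Mtot k / r).descFactorial c : ℝ) /
              ((Mtot k).descFactorial (r * c) : ℝ) ∧
        (2 * r ^ 2 * c ^ 2 ≤ Mtot k →
          ∃ E : ℝ, |E| ≤ C * (r : ℝ) ^ 2 * (c : ℝ) ^ 2 / (Mtot k : ℝ) ∧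
            (Set.ncard {Q ∈ Lam r k | ∀ j, U j ∈ Q} : ℝ) / (Set.ncard (Lam r k) : ℝ) =
              ((Nat.factorial (r - 1) : ℝ) ^ c / (Mtot k : ℝ) ^ (c * (r - 1))) *
                Real.exp E) := by
  refine ⟨4, by norm_num, ?_⟩
  intro r n k c U hr hdvd hU hdis hc
  have hex := exact_part r k c U hr hdvd hU hdis hc
  refine ⟨hex, fun hM => ?_⟩
  rw [hex]
  rcases Nat.eq_zero_or_pos c with rfl | hc0
  · exact ⟨0, by simp, by simp⟩
  obtain ⟨m, hm⟩ := hdvd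
  have hr0 : 0 < r := by omega
  have hmr : Mtot k / r = m := by rw [hm, Nat.mul_div_cancel_left _ hr0]
  rw [hmr] at hc ⊢
  have hm0 : 0 < m := by omega
  rw [hm] at hM ⊢
  have hrc : r * c ≤ r ^ 2 * c ^ 2 := by
    rw [← mul_pow]; exact Nat.le_self_pow (by norm_num) _
  have hM1 : 2 * (r * c) ≤ r * m := by
    rw [mul_assoc] at hM; omega
  have hM2 : 2 * c ≤ m := by
    apply Nat.le_of_mul_le_mul_left _ hr0
    linarith
  obtain ⟨E1, h1, h1'⟩ := desc_asymp m hm0 c hM2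
  obtain ⟨E2, h2, h2'⟩ := desc_asymp (r * m) (by positivity) (r * c) hM1
  have hrR : (0 : ℝ) < r := by exact_mod_cast hr0
  have hr1 : (1 : ℝ) ≤ r := by exact_mod_cast hr0
  have hmR : (0 : ℝ) < m := by exact_mod_cast hm0
  refine ⟨E1 - E2, ?_, ?_⟩
  · have h3 : 2 * (c : ℝ) ^ 2 / m ≤ 2 * (r : ℝ) ^ 2 * c ^ 2 / (r * m) := by
      rw [div_le_div_iff₀ hmR (by positivity)]
      have : (r : ℝ) ≤ r ^ 2 := by nlinarith
      have h4 : 0 ≤ 2 * (c : ℝ) ^ 2 * m := by positivity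
      nlinarith [mul_le_mul_of_nonneg_right this h4]
    push_cast at h2 ⊢
    calc |E1 - E2| ≤ |E1| + |E2| := abs_sub _ _
      _ ≤ 2 * (r : ℝ) ^ 2 * c ^ 2 / (r * m) + 2 * (r * c : ℝ) ^ 2 / (r * m) :=
        add_le_add (h1.trans h3) h2
      _ = _ := by ring
  · rw [h1', h2', Real.exp_sub]
    obtain ⟨s, rfl⟩ : ∃ s, r = s + 1 := ⟨r - 1, by omega⟩
    rw [Nat.add_sub_cancel, Nat.factorial_succ]
    have hexp : (((s + 1) * m : ℕ) : ℝ) ^ ((s + 1) * c) =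
        (((s + 1) * m : ℕ) : ℝ) ^ (c * s) * (((s + 1) * m : ℕ) : ℝ) ^ c := by
      rw [← pow_add]; congr 1; ring
    rw [hexp]
    push_cast
    rw [mul_pow, mul_pow _ _ c]
    have := Real.exp_pos E2
    field_simp
end
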